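/- arXiv:math/0509325 — 4 statements merged into one kernel-verified Lean document; each statement's English description precedes it below -/
import Mathlib

section
/- Let H ⊆ Z_2^m be an extended 1-perfect (m, 2^m/(2m), 4) code containing the all-zero word. Then (1/|H|)·W_H(X+Y, X−Y) = X^m + Y^m + (2m−2)(XY)^{m/2}, where W_H(X,Y) = Σ_{c∈H} X^{m−wt(c)} Y^{wt(c)} is the weight enumerator. -/
/-- The sign of a bit: `0 ↦ 1` and `1 ↦ -1`. -/
def bitSign (a : ZMod 2) : ℝ := if a = 0 then 1 else -1

/-- The character of the binary cube attached to a set of coordinates. -/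
def cubeChar {ι : Type*} (t : Finset ι) (x : ι → ZMod 2) : ℝ := ∏ j ∈ t, bitSign (x j)

theorem bitSign_add (a b : ZMod 2) : bitSign (a + b) = bitSign a * bitSign b := by
  have h : ∀ c : ZMod 2, c = 0 ∨ c = 1 := by decide
  have h2 : (1 : ZMod 2) + 1 = 0 := by decide
  rcases h a with rfl | rfl <;> rcases h b with rfl | rfl <;> simp [bitSign, h2]

theorem cubeChar_add {ι : Type*} (t : Finset ι) (x y : ι → ZMod 2) :
    cubeChar t (x + y) = cubeChar t x * cubeChar t y := by
  simp [cubeChar, bitSign_add, Finset.prod_mul_distrib]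

theorem hammingDist_self_add {ι : Type*} [Fintype ι] (c x : ι → ZMod 2) :
    hammingDist c (c + x) = hammingNorm x := by
  rw [hammingDist_eq_hammingNorm]; simp

section

variable {ι : Type*} [DecidableEq ι]

theorem cubeChar_single (t : Finset ι) (j : ι) :
    cubeChar t (Pi.single j 1) = if j ∈ t then -1 else 1 := by
  unfold cubeChar
  have h : ∀ k ∈ t, bitSign ((Pi.single j 1 : ι → ZMod 2) k) = if k = j then -1 else 1 := by
    intro k _
    by_cases hk : k = j
    · subst hk; simp [bitSign]
    · simp [bitSign, hk]
  rw [Finset.prod_congr rfl h, Finset.prod_ite_eq']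

variable [Fintype ι]

theorem sum_cubeChar_single (t : Finset ι) :
    ∑ j, cubeChar t (Pi.single j 1) = (Fintype.card ι : ℝ) - 2 * t.card := by
  have h : ∀ j, cubeChar t (Pi.single j 1) = 1 - 2 * (if j ∈ t then 1 else 0) := by
    intro j
    rw [cubeChar_single]
    split_ifs <;> norm_num
  simp [h, Finset.sum_sub_distrib, mul_comm]

theorem sum_cubeChar_eq_zero {t : Finset ι} (ht : t.Nonempty) :
    ∑ x : ι → ZMod 2, cubeChar t x = 0 := by
  obtain ⟨j, hj⟩ := ht
  have h := Equiv.sum_comp (Equiv.addRight (Pi.single j 1 : ι → ZMod 2)) (cubeChar t)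
  simp only [Equiv.coe_addRight, cubeChar_add, cubeChar_single, if_pos hj] at h
  rw [← Finset.sum_mul] at h
  linarith

theorem sum_pow_mul_cubeChar (X Y : ℝ) (x : ι → ZMod 2) :
    ∑ t : Finset ι, X ^ (Fintype.card ι - t.card) * Y ^ t.card * cubeChar t x
      = (X + Y) ^ (Fintype.card ι - hammingNorm x) * (X - Y) ^ hammingNorm x := by
  have h := Finset.prod_add (fun j => Y * bitSign (x j)) (fun _ => X) (Finset.univ : Finset ι)
  rw [Finset.powerset_univ] at h
  have hl : ∏ j, (Y * bitSign (x j) + X)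
      = (X + Y) ^ (Fintype.card ι - hammingNorm x) * (X - Y) ^ hammingNorm x := by
    have h1 : ∀ j, Y * bitSign (x j) + X = if x j ≠ 0 then X - Y else X + Y := by
      intro j
      by_cases hj : x j = 0 <;> simp [bitSign, hj] <;> ring
    simp only [h1, Finset.prod_ite, Finset.prod_const]
    rw [mul_comm, Finset.filter_not, Finset.card_sdiff_of_subset (Finset.filter_subset _ _)]
    rfl
  rw [← hl, h]
  refine Finset.sum_congr rfl fun t _ => ?_
  rw [Finset.prod_mul_distrib, Finset.prod_const, Finset.prod_const,
    Finset.card_sdiff_of_subset (Finset.subset_univ t), Finset.card_univ, cubeChar]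
  ring

theorem sum_cubeChar_index (x : ι → ZMod 2) :
    ∑ t : Finset ι, cubeChar t x = if x = 0 then 2 ^ Fintype.card ι else 0 := by
  have h := sum_pow_mul_cubeChar 1 1 x
  simp only [one_pow, one_mul, sub_self] at h
  rw [h]
  split_ifs with hx
  · subst hx; norm_num
  · rw [zero_pow (by simpa using hx), mul_zero]

theorem hammingNorm_single_le (j : ι) (a : ZMod 2) :
    hammingNorm (Pi.single j a : ι → ZMod 2) ≤ 1 := by
  refine (Finset.card_le_card (t := {j}) fun k hk => ?_).trans_eq (Finset.card_singleton j)
  by_contra hne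
  simp_all

/-- A distance-4 code of size `2^m/(2m)` tiles the cube by translates of
`{e_j + a e_i | j, a}`. -/
theorem bijective_code_add_single (H : Finset (ι → ZMod 2))
    (hcard : H.card * (2 * Fintype.card ι) = 2 ^ Fintype.card ι)
    (hdist : ∀ u ∈ H, ∀ v ∈ H, u ≠ v → 4 ≤ hammingDist u v) (i : ι) :
    Function.Bijective (fun p : H × ι × ZMod 2 =>
      (p.1 : ι → ZMod 2) + (Pi.single p.2.1 1 + Pi.single i p.2.2)) := by
  rw [Fintype.bijective_iff_injective_and_card]
  refine ⟨?_, ?_⟩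
  · rintro ⟨⟨c, hc⟩, j, a⟩ ⟨⟨d, hd⟩, k, b⟩ h
    simp only at h
    have hcd : c = d := by
      by_contra hne
      have h4 := hdist c hc d hd hne
      have e : -c + d = (-Pi.single k 1 + Pi.single j 1) + Pi.single i (a - b) := by
        rw [Pi.single_sub]
        linear_combination (-1 : ι → ZMod 2) * h
      rw [hammingDist_eq_hammingNorm, e] at h4
      have t1 := hammingDist_triangle 0 (-Pi.single k 1 + Pi.single j 1 : ι → ZMod 2)
        ((-Pi.single k 1 + Pi.single j 1) + Pi.single i (a - b))
      have t2 := hammingDist_triangle (Pi.single k 1 : ι → ZMod 2) 0 (Pi.single j 1)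
      simp only [hammingDist_zero_left, hammingDist_self_add] at t1
      rw [← hammingDist_eq_hammingNorm] at t1
      rw [hammingDist_zero_right, hammingDist_zero_left] at t2
      have n1 := hammingNorm_single_le k 1
      have n2 := hammingNorm_single_le j 1
      have n3 := hammingNorm_single_le i (a - b)
      omega
    subst hcd
    have h' := add_left_cancel h
    have hjk : j = k := by
      by_contra hne
      by_cases hj : j = i
      · have := congrFun h' k
        have hk : k ≠ i := fun hk => hne (hj.trans hk.symm)
        simp [hk, Ne.symm hne] at this
      · have := congrFun h' j
        simp [hj, hne] at this
    subst hjk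
    have hab := congrFun (add_left_cancel h') i
    simp only [Pi.single_eq_same] at hab
    subst hab
    rfl
  · simp only [Fintype.card_prod, Fintype.card_coe, ZMod.card, Fintype.card_fun]
    rw [mul_comm (Fintype.card ι), hcard]

theorem sum_code_cubeChar_eq_zero (H : Finset (ι → ZMod 2))
    (hcard : H.card * (2 * Fintype.card ι) = 2 ^ Fintype.card ι)
    (hdist : ∀ u ∈ H, ∀ v ∈ H, u ≠ v → 4 ≤ hammingDist u v)
    {t : Finset ι} (ht : t.Nonempty) (hu : t ≠ Finset.univ)
    (hhalf : 2 * t.card ≠ Fintype.card ι) :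
    ∑ c ∈ H, cubeChar t c = 0 := by
  obtain ⟨i, hi⟩ : ∃ i, i ∉ t := by
    by_contra! h
    exact hu (Finset.eq_univ_iff_forall.2 h)
  have h := (bijective_code_add_single H hcard hdist i).sum_comp (cubeChar t)
  have hsingle : ∀ a : ZMod 2, cubeChar t (Pi.single i a) = 1 := by
    intro a
    refine Finset.prod_eq_one fun k hk => ?_
    have : k ≠ i := fun e => hi (e ▸ hk)
    simp [bitSign, this]
  rw [sum_cubeChar_eq_zero ht] at h
  simp only [cubeChar_add, hsingle, mul_one, Fintype.sum_prod_type, Finset.sum_const,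
    Finset.card_univ, ZMod.card, ← Finset.smul_sum, ← Finset.mul_sum, ← Finset.sum_mul,
    sum_cubeChar_single] at h
  rw [Finset.sum_coe_sort H (cubeChar t)] at h
  have hne : (Fintype.card ι : ℝ) - 2 * t.card ≠ 0 := by
    rw [sub_ne_zero]
    exact_mod_cast hhalf.symm
  simpa [hne] using h

/-- A weighted sum over the spectrum of the code is supported on the weights `0`, `m/2`, `m`. -/
theorem sum_mul_sum_code_cubeChar (H : Finset (ι → ZMod 2))
    (hcard : H.card * (2 * Fintype.card ι) = 2 ^ Fintype.card ι)
    (hdist : ∀ u ∈ H, ∀ v ∈ H, u ≠ v → 4 ≤ hammingDist u v)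
    {n : ℕ} (hn : Fintype.card ι = 2 * n) (hn0 : 0 < n) (f : ℕ → ℝ) :
    ∑ t : Finset ι, f t.card * ∑ c ∈ H, cubeChar t c
      = f 0 * H.card + f (2 * n) * ∑ c ∈ H, cubeChar Finset.univ c
        + f n * ∑ t : Finset ι with t.card = n, ∑ c ∈ H, cubeChar t c := by
  have key : ∀ t : Finset ι, f t.card * ∑ c ∈ H, cubeChar t c
      = (if t = ∅ then f 0 * H.card else 0)
        + (if t = Finset.univ then f (2 * n) * ∑ c ∈ H, cubeChar Finset.univ c else 0)
        + f n * (if t.card = n then ∑ c ∈ H, cubeChar t c else 0) := by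
    intro t
    have huniv : (Finset.univ : Finset ι).card = 2 * n := by rw [Finset.card_univ, hn]
    by_cases h0 : t = ∅
    · subst h0
      have hne : (∅ : Finset ι) ≠ Finset.univ := by
        intro e
        rw [← e, Finset.card_empty] at huniv
        omega
      simp [cubeChar, hne, hn0.ne]
    · by_cases h1 : t = Finset.univ
      · subst h1
        have : 2 * n ≠ n := by omega
        rw [huniv]
        simp [h0, this]
      · by_cases h2 : t.card = n
        · simp [h0, h1, h2]
        · rw [sum_code_cubeChar_eq_zero H hcard hdist (Finset.nonempty_iff_ne_empty.2 h0) h1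
            (by omega)]
          simp [h0, h1, h2]
  rw [Finset.sum_congr rfl fun t _ => key t]
  rw [Finset.sum_add_distrib, Finset.sum_add_distrib, ← Finset.mul_sum, Finset.sum_filter,
    Finset.sum_ite_eq', Finset.sum_ite_eq', if_pos (Finset.mem_univ _),
    if_pos (Finset.mem_univ _)]

/-- The MacWilliams transform of the weight enumerator of an extended 1-perfect code. -/
theorem sum_code_weight_transform (H : Finset (ι → ZMod 2))
    (hcard : H.card * (2 * Fintype.card ι) = 2 ^ Fintype.card ι)
    (hdist : ∀ u ∈ H, ∀ v ∈ H, u ≠ v → 4 ≤ hammingDist u v) (hzero : 0 ∈ H)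
    {n : ℕ} (hn : Fintype.card ι = 2 * n) (hn0 : 0 < n) (X Y : ℝ) :
    ∑ c ∈ H, (X + Y) ^ (2 * n - hammingNorm c) * (X - Y) ^ hammingNorm c
      = H.card * (X ^ (2 * n) + Y ^ (2 * n) + (4 * n - 2) * (X * Y) ^ n) := by
  have hX := sum_mul_sum_code_cubeChar H hcard hdist hn hn0
    fun k => X ^ (2 * n - k) * Y ^ k
  have h0 := sum_mul_sum_code_cubeChar H hcard hdist hn hn0 fun _ => 1
  have h1 := sum_mul_sum_code_cubeChar H hcard hdist hn hn0 fun k => 2 * n - 2 * k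
  simp only [Finset.mul_sum (s := H)] at hX h0 h1
  rw [Finset.sum_comm] at hX h0 h1
  have hL : ∑ c ∈ H, ∑ t : Finset ι, X ^ (2 * n - t.card) * Y ^ t.card * cubeChar t c
      = ∑ c ∈ H, (X + Y) ^ (2 * n - hammingNorm c) * (X - Y) ^ hammingNorm c := by
    refine Finset.sum_congr rfl fun c _ => ?_
    rw [← hn, sum_pow_mul_cubeChar]
  have hL0 : ∑ c ∈ H, ∑ t : Finset ι, 1 * cubeChar t c = H.card * (4 * n) := by
    have hc : (H.card : ℝ) * (2 * (2 * n)) = 2 ^ Fintype.card ι := by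
      rw [hn] at hcard ⊢
      exact_mod_cast hcard
    simp only [one_mul, sum_cubeChar_index, Finset.sum_ite_eq', hzero, if_true]
    rw [← hc]
    ring
  have hL1 : ∑ c ∈ H, ∑ t : Finset ι, (2 * (n : ℝ) - 2 * t.card) * cubeChar t c = 0 := by
    refine Finset.sum_eq_zero fun c hc => ?_
    have e : ∀ t : Finset ι, (2 * (n : ℝ) - 2 * t.card) * cubeChar t c
        = ∑ j, cubeChar t (Pi.single j 1 + c) := by
      intro t
      simp only [cubeChar_add, ← Finset.sum_mul, sum_cubeChar_single, hn]
      push_cast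
      ring
    rw [Finset.sum_congr rfl fun t _ => e t, Finset.sum_comm]
    refine Finset.sum_eq_zero fun j _ => ?_
    rw [sum_cubeChar_index, if_neg]
    intro hjc
    have hw := hammingNorm_single_le j (1 : ZMod 2)
    have hcj : hammingDist (0 : ι → ZMod 2) c = hammingNorm (Pi.single j 1 : ι → ZMod 2) := by
      rw [← hjc, add_comm, hammingDist_comm, hammingDist_self_add]
    have hne : (0 : ι → ZMod 2) ≠ c := by
      rintro rfl
      simpa using congrFun hjc j
    have := hdist 0 hzero c hc hne
    omega
  rw [hL] at hX
  rw [hL0] at h0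
  rw [hL1] at h1
  simp only [← Finset.mul_sum] at hX h0 h1
  have hnR : (n : ℝ) ≠ 0 := by exact_mod_cast hn0.ne'
  have hU : ∑ c ∈ H, cubeChar Finset.univ c = H.card := by
    push_cast at h1
    apply mul_left_cancel₀ hnR
    linear_combination h1 / 2
  rw [hU] at hX h0
  rw [hX]
  simp only [Nat.sub_zero, pow_zero, Nat.sub_self, two_mul, Nat.add_sub_cancel, mul_pow] at h0 ⊢
  linear_combination (- X ^ n * Y ^ n) * h0

end

/-- MacWilliams transform of an extended 1-perfect `(m, 2^m/(2m), 4)` code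
containing the all-zero word: with `m = 2^μ`,
`(1/|H|)·W_H(X+Y, X−Y) = X^m + Y^m + (2m−2)(XY)^{m/2}`. -/
theorem stmt_9 (μ : ℕ) (hμ : 2 ≤ μ)
    (H : Finset (Fin (2 ^ μ) → ZMod 2))
    (hcard : H.card = 2 ^ (2 ^ μ) / (2 * 2 ^ μ))
    (hdist : ∀ u ∈ H, ∀ v ∈ H, u ≠ v → 4 ≤ hammingDist u v)
    (hzero : (0 : Fin (2 ^ μ) → ZMod 2) ∈ H) :
    ∀ X Y : ℝ,
      (H.card : ℝ)⁻¹ *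
          ∑ c ∈ H, (X + Y) ^ (2 ^ μ - hammingNorm c) * (X - Y) ^ (hammingNorm c)
        = X ^ (2 ^ μ) + Y ^ (2 ^ μ)
            + ((2 * 2 ^ μ : ℕ) - 2 : ℝ) * (X * Y) ^ (2 ^ (μ - 1)) := by
  intro X Y
  have hdvd : 2 * 2 ^ μ ∣ 2 ^ (2 ^ μ) := by
    rw [← pow_succ']
    exact pow_dvd_pow 2 Nat.lt_two_pow_self
  have hc : H.card * (2 * Fintype.card (Fin (2 ^ μ))) = 2 ^ Fintype.card (Fin (2 ^ μ)) := by
    rw [Fintype.card_fin, hcard, Nat.div_mul_cancel hdvd]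
  have hm : 2 ^ μ = 2 * 2 ^ (μ - 1) := by
    rw [← pow_succ', Nat.sub_add_cancel (by omega)]
  have h := sum_code_weight_transform H hc hdist hzero
    (n := 2 ^ (μ - 1)) (by rw [Fintype.card_fin, hm]) (by positivity) X Y
  have hH : (H.card : ℝ) ≠ 0 := by
    exact_mod_cast (Finset.card_pos.2 ⟨0, hzero⟩).ne'
  rw [← hm] at h
  rw [h, inv_mul_cancel_left₀ hH, hm]
  push_cast
  ring
end

section
/- Let C and C^⊥ be dual linear codes over Z_{2^k} of length n, let C_bin = φ(C) be the Z_{2^k}-linear binary code obtained via the generalized Gray map φ, and let C̃_⊥ = Φ(C^⊥) be the co-Z_{2^k}-linear binary code obtained via the map Φ. Then C_bin and C̃_⊥ are formally dual: W_{C_bin}(X,Y) = (1/|C̃_⊥|)·W_{C̃_⊥}(X+Y, X−Y), i.e., their weight enumerators satisfy the MacWilliams identity. -/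
open Finset

/-- The monomial `X ^ (number of zeros of u) * Y ^ (weight of u)`, written as a product. -/
noncomputable def weightMonomial {ι : Type*} [Fintype ι] (X Y : ℂ) (u : ι → ZMod 2) : ℂ :=
  ∏ j, if u j = 0 then X else Y

/-- The nontrivial complex sign character of `ZMod 2`. -/
noncomputable def binarySign (b : ZMod 2) : ℂ := if b = 0 then 1 else -1

theorem binarySign_add (b c : ZMod 2) :
    binarySign (b + c) = binarySign b * binarySign c := by
  have h01 : ∀ d : ZMod 2, d = 0 ∨ d = 1 := by decide
  have h11 : (1 : ZMod 2) + 1 = 0 := by decide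
  rcases h01 b with rfl | rfl <;> rcases h01 c with rfl | rfl <;> simp [binarySign, h11]

theorem weightMonomial_eq {ι : Type*} [Fintype ι] (X Y : ℂ) (u : ι → ZMod 2) :
    weightMonomial X Y u = X ^ (Fintype.card ι - hammingNorm u) * Y ^ hammingNorm u := by
  have hc := card_filter_add_card_filter_not (s := (univ : Finset ι)) (fun j => u j = 0)
  rw [weightMonomial, prod_ite, prod_const, prod_const]
  have h1 : hammingNorm u = #{j | ¬ u j = 0} := rfl
  rw [h1]
  congr 2
  rw [card_univ] at hc
  omega

/-- The character sum of the weight monomials over the binary Hamming space. -/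
theorem sum_sign_mul_weightMonomial {ι : Type*} [Fintype ι] [DecidableEq ι] (X Y : ℂ)
    (u : ι → ZMod 2) :
    ∑ v : ι → ZMod 2, (∏ j, binarySign (u j * v j)) * weightMonomial X Y v
      = weightMonomial (X + Y) (X - Y) u := by
  have h : ∀ j, (if u j = 0 then X + Y else X - Y)
      = ∑ b : ZMod 2, binarySign (u j * b) * (if b = 0 then X else Y) := by
    intro j
    have h2 : ∀ f : ZMod 2 → ℂ, ∑ b, f b = f 0 + f 1 := fun f => Fin.sum_univ_two f
    rw [h2]
    have h01 : ∀ d : ZMod 2, d = 0 ∨ d = 1 := by decide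
    rcases h01 (u j) with h | h <;> simp [h, binarySign, sub_eq_add_neg]
  simp only [weightMonomial, h]
  rw [prod_univ_sum, Fintype.piFinset_univ]
  simp only [prod_mul_distrib]

theorem weightMonomial_two_zero {ι : Type*} [Fintype ι] [DecidableEq ι] (u : ι → ZMod 2) :
    weightMonomial 2 0 u = if u = 0 then (2 : ℂ) ^ Fintype.card ι else 0 := by
  split_ifs with h
  · simp [weightMonomial, h]
  · obtain ⟨j, hj⟩ := Function.ne_iff.mp h
    exact prod_eq_zero (mem_univ j) (if_neg hj)

theorem sum_binarySign {ι : Type*} [Fintype ι] (v : ι → ZMod 2) :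
    ∑ j, binarySign (v j) = (Fintype.card ι : ℂ) - 2 * hammingNorm v := by
  have h : ∀ j, binarySign (v j) = 1 - 2 * (if v j ≠ 0 then 1 else 0) := by
    intro j
    by_cases h : v j = 0 <;> simp [binarySign, h]
    norm_num
  simp only [h, sum_sub_distrib, ← mul_sum, sum_boole]
  simp [hammingNorm]

/-- An eigenfunction of the hypercube graph has a Fourier transform concentrated on one weight,
which determines its weight distribution. -/
theorem sum_mul_weightMonomial_of_eigenfunction {ι : Type*} [Fintype ι] [DecidableEq ι]
    (F : (ι → ZMod 2) → ℂ) (w : ℕ)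
    (hF : ∀ u, ∑ j, F (u + Pi.single j 1) = ((Fintype.card ι : ℂ) - 2 * w) * F u)
    (X Y : ℂ) :
    ∑ u, F u * weightMonomial (X + Y) (X - Y) u
      = 2 ^ Fintype.card ι * F 0 * (X ^ (Fintype.card ι - w) * Y ^ w) := by
  set G : (ι → ZMod 2) → ℂ := fun v => ∑ u, F u * ∏ j, binarySign (u j * v j) with hG
  have hsum : ∀ X Y : ℂ, ∑ u, F u * weightMonomial (X + Y) (X - Y) u
      = ∑ v, G v * weightMonomial X Y v := by
    intro X Y
    simp only [← sum_sign_mul_weightMonomial, hG, mul_sum, sum_mul]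
    rw [sum_comm]
    simp only [mul_assoc]
  have hsupp : ∀ v, G v ≠ 0 → hammingNorm v = w := by
    intro v hv
    have hshift : ∀ j, ∑ u : ι → ZMod 2, F (u + Pi.single j 1) * ∏ i, binarySign (u i * v i)
        = binarySign (v j) * G v := by
      intro j
      rw [hG, mul_sum]
      conv_rhs => rw [← Equiv.sum_comp (Equiv.addRight (Pi.single j (1 : ZMod 2)))]
      refine sum_congr rfl fun u _ => ?_
      have : ∏ i, binarySign ((u + Pi.single j (1 : ZMod 2) : ι → ZMod 2) i * v i)
          = (∏ i, binarySign (u i * v i)) * binarySign (v j) := by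
        simp only [Pi.add_apply, add_mul, binarySign_add, prod_mul_distrib]
        congr 1
        rw [prod_eq_single j]
        · simp
        · intro i _ hi
          simp [Pi.single_eq_of_ne hi, binarySign]
        · simp
      have hs : binarySign (v j) * binarySign (v j) = 1 := by
        by_cases h : v j = 0 <;> simp [binarySign, h]
      simp only [Equiv.coe_addRight]
      rw [this]
      linear_combination (-F (u + Pi.single j 1) * ∏ i, binarySign (u i * v i)) * hs
    have h1 : ((Fintype.card ι : ℂ) - 2 * w) * G v
        = ((Fintype.card ι : ℂ) - 2 * hammingNorm v) * G v := by
      rw [← sum_binarySign v, sum_mul]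
      simp only [← hshift]
      rw [sum_comm, hG, mul_sum]
      refine sum_congr rfl fun u _ => ?_
      rw [← sum_mul, hF, mul_assoc]
    have h2 := mul_right_cancel₀ hv h1
    have h3 : (hammingNorm v : ℂ) = w := by linear_combination (1 / 2 : ℂ) * h2
    exact_mod_cast h3
  have htot : ∑ v, G v = 2 ^ Fintype.card ι * F 0 := by
    have h := hsum 1 1
    have h1 : ∀ v : ι → ZMod 2, weightMonomial 1 1 v = 1 := by simp [weightMonomial]
    simp only [h1, mul_one, sub_self, one_add_one_eq_two, weightMonomial_two_zero] at h
    rw [← h]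
    simp [mul_comm]
  rw [hsum, ← htot, sum_mul]
  refine sum_congr rfl fun v _ => ?_
  by_cases hv : G v = 0
  · simp [hv]
  · rw [weightMonomial_eq, hsupp v hv]

/-- Orthogonality of characters on a submodule of `(ZMod N)^ι`. -/
theorem sum_submodule_stdAddChar {ι : Type*} [Fintype ι] {N : ℕ} [NeZero N]
    (C : Submodule (ZMod N) (ι → ZMod N)) [Fintype C] (y : ι → ZMod N)
    [Decidable (∀ x ∈ C, ∑ i, x i * y i = 0)] :
    ∑ x : C, ZMod.stdAddChar (∑ i, x.1 i * y i)
      = if ∀ x ∈ C, ∑ i, x i * y i = 0 then (Fintype.card C : ℂ) else 0 := by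
  split_ifs with h
  · rw [sum_congr rfl fun x _ => by rw [h x.1 x.2, AddChar.map_zero_eq_one]]
    simp
  · push Not at h
    obtain ⟨x, hx, hne⟩ := h
    let e : C →+ ZMod N :=
      { toFun := fun x => ∑ i, x.1 i * y i
        map_zero' := by simp
        map_add' := fun x z => by simp [add_mul, sum_add_distrib] }
    refine AddChar.sum_eq_zero_of_ne_one
      (ψ := (ZMod.stdAddChar (N := N)).compAddMonoidHom e) fun h1 => hne ?_
    have h2 := DFunLike.congr_fun h1 ⟨x, hx⟩
    refine ZMod.injective_stdAddChar ?_
    rw [AddChar.map_zero_eq_one]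
    exact h2

/-- Half of the residues modulo an even number have a given parity. -/
theorem card_filter_castHom_eq {N : ℕ} [NeZero N] (h2 : 2 ∣ N) (b : ZMod 2) :
    2 * #{i : ZMod N | ZMod.castHom h2 (ZMod 2) i = b} = N := by
  have hdec : ∀ b c : ZMod 2, ¬ c = b ↔ c = b + 1 := by decide
  have hc := card_filter_add_card_filter_not (s := (univ : Finset (ZMod N)))
    (fun i => ZMod.castHom h2 (ZMod 2) i = b)
  have he : #{i : ZMod N | ZMod.castHom h2 (ZMod 2) i = b}
      = #{i : ZMod N | ¬ ZMod.castHom h2 (ZMod 2) i = b} := by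
    refine card_equiv (Equiv.addRight 1) fun i => ?_
    simp only [mem_filter_univ, Equiv.coe_addRight, map_add, map_one, hdec]
    exact (add_left_inj (1 : ZMod 2)).symm
  rw [← he, card_univ, ZMod.card] at hc
  omega

theorem two_mul_hammingNorm_gray {k : ℕ} (hk : 2 ≤ k)
    (a : ZMod (2 ^ k) → Fin (2 ^ (k - 1)) → ZMod 2) (ha_zero : a 0 = 0)
    (ha_compl : ∀ x : ZMod (2 ^ k), a (x + (2 ^ (k - 1) : ZMod (2 ^ k))) = a x + 1)
    (ha_dist : ∀ x y : ZMod (2 ^ k), x ≠ y → 2 ^ (k - 2) ≤ hammingDist (a x) (a y))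
    (x : ZMod (2 ^ k)) (hx : x ≠ 0) (hx' : x ≠ 2 ^ (k - 1)) :
    2 * hammingNorm (a x) = 2 ^ (k - 1) := by
  have hone : a (2 ^ (k - 1)) = 1 := by simpa [ha_zero] using ha_compl 0
  have h1 := ha_dist x 0 hx
  have h2 := ha_dist x _ hx'
  rw [ha_zero, hammingDist_zero_right] at h1
  rw [hone] at h2
  have hc := card_filter_add_card_filter_not
    (s := (univ : Finset (Fin (2 ^ (k - 1))))) (fun j => a x j ≠ 0)
  have h3 : hammingDist (a x) 1 = #{j | ¬ a x j ≠ 0} := by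
    have : ∀ c : ZMod 2, c ≠ 1 ↔ ¬ c ≠ 0 := by decide
    simp only [hammingDist, Pi.one_apply, this]
  have h4 : hammingNorm (a x) = #{j | a x j ≠ 0} := rfl
  rw [card_univ, Fintype.card_fin] at hc
  obtain ⟨l, rfl⟩ := Nat.exists_eq_add_of_le' hk
  have h5 : 2 ^ (l + 2 - 1) = 2 * 2 ^ (l + 2 - 2) := by
    simp [pow_succ, mul_comm]
  omega

/-- The sum of a character over the residues of the parity opposite to that of `t`. -/
theorem sum_stdAddChar_opposite_parity {k : ℕ} (hk : 2 ≤ k) (h2 : 2 ∣ 2 ^ k)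
    (a : ZMod (2 ^ k) → Fin (2 ^ (k - 1)) → ZMod 2) (ha_zero : a 0 = 0)
    (ha_compl : ∀ x : ZMod (2 ^ k), a (x + (2 ^ (k - 1) : ZMod (2 ^ k))) = a x + 1)
    (ha_dist : ∀ x y : ZMod (2 ^ k), x ≠ y → 2 ^ (k - 2) ≤ hammingDist (a x) (a y))
    (x t : ZMod (2 ^ k)) :
    ∑ i with ZMod.castHom h2 (ZMod 2) i = ZMod.castHom h2 (ZMod 2) t + 1,
        ZMod.stdAddChar (x * i)
      = ((2 ^ (k - 1) : ℕ) - 2 * hammingNorm (a x) : ℂ) * ZMod.stdAddChar (x * t) := by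
  have hpow : 2 ^ k = 2 * 2 ^ (k - 1) := by
    rw [← pow_succ']
    congr 1
    omega
  have hcard := card_filter_castHom_eq h2 (ZMod.castHom h2 (ZMod 2) t + 1)
  have htwo : (2 : ZMod (2 ^ k)) * 2 ^ (k - 1) = 0 := by
    exact_mod_cast (congrArg (Nat.cast : ℕ → ZMod (2 ^ k)) hpow).symm.trans (ZMod.natCast_self _)
  by_cases hx : x = 0
  · subst hx
    simp only [zero_mul, AddChar.map_zero_eq_one, sum_const, ha_zero, hammingNorm_zero, mul_one,
      nsmul_eq_mul, Nat.cast_zero, mul_zero, sub_zero]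
    congr 1
    omega
  by_cases hx' : x = 2 ^ (k - 1)
  · have hw : hammingNorm (a x) = 2 ^ (k - 1) := by
      have hone : a x = 1 := by simpa [ha_zero, hx'] using ha_compl 0
      rw [hone]
      simp [hammingNorm]
    have hodd : ∀ i : ZMod (2 ^ k), ZMod.castHom h2 (ZMod 2) i = 1 → x * i = x := by
      intro i hi
      have h3 : ((i.val : ℕ) : ZMod 2) = ((1 : ℕ) : ZMod 2) := by
        rw [← ZMod.natCast_zmod_val i, map_natCast] at hi
        simpa using hi
      rw [ZMod.natCast_eq_natCast_iff'] at h3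
      have h4 : i = 2 * ((i.val / 2 : ℕ) : ZMod (2 ^ k)) + 1 := by
        conv_lhs => rw [← ZMod.natCast_zmod_val i, ← Nat.div_add_mod i.val 2, h3]
        push_cast
        rfl
      rw [h4, hx']
      linear_combination ((i.val / 2 : ℕ) : ZMod (2 ^ k)) * htwo
    have hneg : (ZMod.stdAddChar x : ℂ) = -1 := by
      have hsq : (ZMod.stdAddChar x : ℂ) * ZMod.stdAddChar x = 1 := by
        rw [← AddChar.map_add_eq_mul, ← two_mul, hx', htwo, AddChar.map_zero_eq_one]
      rcases mul_self_eq_one_iff.mp hsq with h | h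
      · exact absurd (ZMod.injective_stdAddChar (h.trans (AddChar.map_zero_eq_one _).symm)) hx
      · exact h
    rw [sum_congr rfl (g := fun _ => -(ZMod.stdAddChar (x * t) : ℂ))]
    · rw [sum_const, hw, nsmul_eq_mul]
      have h5 : #{i : ZMod (2 ^ k) | ZMod.castHom h2 (ZMod 2) i
          = ZMod.castHom h2 (ZMod 2) t + 1} = 2 ^ (k - 1) := by omega
      rw [h5]
      ring
    · intro i hi
      have h6 : x * i = x * t + x := by
        have h7 := hodd (i - t) (by rw [map_sub, (mem_filter_univ _).mp hi]; ring)
        linear_combination h7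
      rw [h6, AddChar.map_add_eq_mul, hneg, mul_neg_one]
  · have hw := two_mul_hammingNorm_gray hk a ha_zero ha_compl ha_dist x hx hx'
    have h2x : x * 2 ≠ 0 := by
      intro h
      have h3 : ((x.val * 2 : ℕ) : ZMod (2 ^ k)) = 0 := by
        push_cast
        rw [ZMod.natCast_zmod_val, h]
      rw [ZMod.natCast_eq_zero_iff] at h3
      have hlt := ZMod.val_lt x
      obtain ⟨c, hc⟩ := h3
      have hc2 : c < 2 := by
        by_contra! hge
        have := Nat.mul_le_mul_left (2 ^ k) hge
        omega
      interval_cases c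
      · exact hx ((ZMod.val_eq_zero x).mp (by omega))
      · refine hx' ?_
        rw [← ZMod.natCast_zmod_val x, show x.val = 2 ^ (k - 1) by omega]
        push_cast
        rfl
    have hne : (ZMod.stdAddChar (x * 2) : ℂ) ≠ 1 := fun h =>
      h2x (ZMod.injective_stdAddChar (h.trans (AddChar.map_zero_eq_one _).symm))
    have hzero : ((2 ^ (k - 1) : ℕ) - 2 * hammingNorm (a x) : ℂ) = 0 := by
      rw [sub_eq_zero]
      exact_mod_cast hw.symm
    rw [hzero, zero_mul]
    refine (mul_eq_zero.mp ?_).resolve_left (sub_ne_zero.mpr hne)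
    rw [sub_mul, one_mul, sub_eq_zero, mul_sum]
    refine sum_equiv (Equiv.addRight 2) (fun i => ?_) (fun i _ => ?_)
    · have : ZMod.castHom h2 (ZMod 2) 2 = 0 := by
        rw [map_ofNat]
        decide
      simp only [mem_filter_univ, Equiv.coe_addRight, map_add, this, add_zero]
    · rw [← AddChar.map_add_eq_mul, Equiv.coe_addRight]
      congr 1
      ring

/-- Flipping the coordinates of a word one at a time meets every extended 1-perfect code of the
opposite parity exactly once. -/
theorem sum_class_neighbors {k : ℕ} (hk : 2 ≤ k) (h2 : 2 ∣ 2 ^ k)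
    (H : ZMod (2 ^ k) → Finset (Fin (2 ^ (k - 1)) → ZMod 2))
    (hdist4 : ∀ j, ∀ u ∈ H j, ∀ v ∈ H j, u ≠ v → 4 ≤ hammingDist u v)
    (hparity : ∀ j, ∀ u ∈ H j, hammingNorm u % 2 = (ZMod.val j) % 2)
    (s : (Fin (2 ^ (k - 1)) → ZMod 2) → ZMod (2 ^ k)) (hs : ∀ u, u ∈ H (s u))
    (f : ZMod (2 ^ k) → ℂ) (u : Fin (2 ^ (k - 1)) → ZMod 2) :
    ∑ j, f (s (u + Pi.single j 1))
      = ∑ i with ZMod.castHom h2 (ZMod 2) i = ZMod.castHom h2 (ZMod 2) (s u) + 1, f i := by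
  have hpow : 2 ^ k = 2 * 2 ^ (k - 1) := by
    rw [← pow_succ']
    congr 1
    omega
  have hpar : ∀ u, ZMod.castHom h2 (ZMod 2) (s u) = ∑ j, u j := by
    intro u
    rw [← ZMod.natCast_zmod_val (s u), map_natCast,
      (ZMod.natCast_eq_natCast_iff' _ _ 2).mpr (hparity _ u (hs u)).symm,
      hammingNorm, card_filter]
    push_cast
    have : ∀ c : ZMod 2, (if c ≠ 0 then (1 : ZMod 2) else 0) = c := by decide
    exact sum_congr rfl fun j _ => this _
  have hinj : Function.Injective fun j => s (u + Pi.single j 1) := by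
    intro i j hij
    by_contra hne
    have hne' : u + Pi.single i (1 : ZMod 2) ≠ u + Pi.single j 1 := fun h => by
      have := congrFun (add_left_cancel h) i
      simp [Pi.single_eq_of_ne hne] at this
    have h4 := hdist4 _ _ (hs (u + Pi.single i 1)) _
      ((congrArg H hij).symm ▸ hs (u + Pi.single j 1)) hne'
    have h5 : hammingDist (u + Pi.single i (1 : ZMod 2)) (u + Pi.single j 1)
        ≤ #({i, j} : Finset (Fin (2 ^ (k - 1)))) := by
      refine card_le_card fun l hl => ?_
      by_contra hcon
      simp only [mem_insert, mem_singleton, not_or] at hcon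
      simp [Pi.single_eq_of_ne hcon.1, Pi.single_eq_of_ne hcon.2] at hl
    have h6 := h5.trans card_le_two
    omega
  have himage : univ.image (fun j => s (u + Pi.single j 1))
      = ({i | ZMod.castHom h2 (ZMod 2) i = ZMod.castHom h2 (ZMod 2) (s u) + 1} :
        Finset (ZMod (2 ^ k))) := by
    refine eq_of_subset_of_card_le ?_ ?_
    · intro i hi
      obtain ⟨j, -, rfl⟩ := mem_image.mp hi
      rw [mem_filter_univ, hpar, hpar]
      simp [sum_add_distrib]
    · have := card_filter_castHom_eq h2 (ZMod.castHom h2 (ZMod 2) (s u) + 1)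
      rw [card_image_of_injective _ hinj, card_univ, Fintype.card_fin]
      omega
  rw [← himage, sum_image fun i _ j _ h => hinj h]

theorem weightMonomial_prod {ι κ : Type*} [Fintype ι] [Fintype κ] (X Y : ℂ)
    (u : ι × κ → ZMod 2) :
    weightMonomial X Y u = ∏ i, weightMonomial X Y fun j => u (i, j) := by
  simp only [weightMonomial, Fintype.prod_prod_type]

theorem weightMonomial_one_zero {ι : Type*} [Fintype ι] [DecidableEq ι] (u : ι → ZMod 2) :
    weightMonomial 1 0 u = if u = 0 then 1 else 0 := by
  split_ifs with h
  · simp [weightMonomial, h]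
  · obtain ⟨j, hj⟩ := Function.ne_iff.mp h
    exact prod_eq_zero (mem_univ j) (if_neg hj)

/-- The unnormalised MacWilliams identity for a submodule `C`, given that for each coordinate the
classifying map `s` and the map `a` are Fourier transforms of each other. -/
theorem sum_submodule_weightMonomial {ι κ : Type*} [Fintype ι] [Fintype κ] [DecidableEq ι]
    [DecidableEq κ] {N : ℕ} [NeZero N] (a : ZMod N → κ → ZMod 2) (s : (κ → ZMod 2) → ZMod N)
    (X Y : ℂ)
    (hF : ∀ x, ∑ u, ZMod.stdAddChar (x * s u) * weightMonomial (X + Y) (X - Y) u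
      = 2 ^ Fintype.card κ * weightMonomial X Y (a x))
    (C : Submodule (ZMod N) (ι → ZMod N)) [Fintype C] (S : Finset (ι × κ → ZMod 2))
    (hS : ∀ u, u ∈ S ↔ ∀ x ∈ C, ∑ i, x i * s (fun j => u (i, j)) = 0) :
    (2 ^ Fintype.card κ) ^ Fintype.card ι *
        ∑ x : C, weightMonomial X Y (fun p : ι × κ => a (x.1 p.1) p.2)
      = Fintype.card C * ∑ u ∈ S, weightMonomial (X + Y) (X - Y) u := by
  classical
  have hx : ∀ x : C, (2 ^ Fintype.card κ) ^ Fintype.card ι *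
        weightMonomial X Y (fun p : ι × κ => a (x.1 p.1) p.2)
      = ∑ u : ι × κ → ZMod 2, ZMod.stdAddChar (∑ i, x.1 i * s (fun j => u (i, j)))
          * weightMonomial (X + Y) (X - Y) u := by
    intro x
    rw [weightMonomial_prod, ← card_univ (α := ι), ← prod_const, ← prod_mul_distrib]
    simp only [← hF]
    rw [prod_univ_sum, Fintype.piFinset_univ, ← (Equiv.curry ι κ (ZMod 2)).sum_comp]
    refine sum_congr rfl fun u _ => ?_
    rw [prod_mul_distrib, weightMonomial_prod]
    congr 1
    exact (map_prod (ZMod.stdAddChar (N := N)).toMonoidHom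
      (fun i => Multiplicative.ofAdd (x.1 i * s fun j => u (i, j))) univ).symm
  rw [mul_sum]
  simp only [hx]
  rw [sum_comm]
  simp only [← sum_mul]
  rw [sum_congr rfl fun u _ => by rw [sum_submodule_stdAddChar C]]
  simp only [ite_mul, zero_mul, ← hS]
  rw [sum_ite_mem, univ_inter, mul_sum]

/-- If `𝒞` and `𝒞^⊥` are dual linear `Z_{2^k}`-codes, then the `Z_{2^k}`-linear binary
code `φ(𝒞)` and the co-`Z_{2^k}`-linear binary code `Φ(𝒞^⊥)` are formally dual:
their weight enumerators satisfy the MacWilliams identity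
`W_{φ(𝒞)}(X,Y) = (1/|Φ(𝒞^⊥)|)·W_{Φ(𝒞^⊥)}(X+Y, X−Y)`.
Here `m = 2^{k-1}`, `a` enumerates a Hadamard `(m,2m,m/2)` code (e.g. `RM(1,k−1)`)
with `a 0 = 0` and `a (x+m) = a x + 1̄`, defining `φ`, and `{H_j}` is a partition of
`Z_2^m` into extended 1-perfect `(m, 2^m/(2m), 4)` codes with `0 ∈ H_0` and weight
parity of `H_j` equal to the parity of `j`, defining `Φ`. -/
theorem stmt_12 (k n : ℕ) (hk : 2 ≤ k)
    (a : ZMod (2 ^ k) → Fin (2 ^ (k - 1)) → ZMod 2)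
    (ha_inj : Function.Injective a)
    (ha_zero : a 0 = 0)
    (ha_compl : ∀ x : ZMod (2 ^ k), a (x + (2 ^ (k - 1) : ZMod (2 ^ k))) = a x + 1)
    (ha_dist : ∀ x y : ZMod (2 ^ k), x ≠ y → 2 ^ (k - 2) ≤ hammingDist (a x) (a y))
    (H : ZMod (2 ^ k) → Finset (Fin (2 ^ (k - 1)) → ZMod 2))
    (hpart : ∀ u : Fin (2 ^ (k - 1)) → ZMod 2, ∃! j, u ∈ H j)
    (hcard : ∀ j, (H j).card = 2 ^ (2 ^ (k - 1)) / (2 * 2 ^ (k - 1)))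
    (hdist4 : ∀ j, ∀ u ∈ H j, ∀ v ∈ H j, u ≠ v → 4 ≤ hammingDist u v)
    (hzero : (0 : Fin (2 ^ (k - 1)) → ZMod 2) ∈ H 0)
    (hparity : ∀ j, ∀ u ∈ H j, hammingNorm u % 2 = (ZMod.val j) % 2)
    (C : Submodule (ZMod (2 ^ k)) (Fin n → ZMod (2 ^ k))) :
    ∀ X Y : ℝ,
      (∑ᶠ u ∈ (fun (x : Fin n → ZMod (2 ^ k)) (p : Fin n × Fin (2 ^ (k - 1))) =>
            a (x p.1) p.2) '' (C : Set (Fin n → ZMod (2 ^ k))),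
          X ^ (n * 2 ^ (k - 1) - hammingNorm u) * Y ^ (hammingNorm u))
        = ({u : Fin n × Fin (2 ^ (k - 1)) → ZMod 2 |
              ∃ y : Fin n → ZMod (2 ^ k), (∀ x ∈ C, ∑ i, x i * y i = 0) ∧
                ∀ i, (fun j => u (i, j)) ∈ H (y i)}.ncard : ℝ)⁻¹ *
            ∑ᶠ u ∈ {u : Fin n × Fin (2 ^ (k - 1)) → ZMod 2 |
                ∃ y : Fin n → ZMod (2 ^ k), (∀ x ∈ C, ∑ i, x i * y i = 0) ∧
                  ∀ i, (fun j => u (i, j)) ∈ H (y i)},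
              (X + Y) ^ (n * 2 ^ (k - 1) - hammingNorm u)
                * (X - Y) ^ (hammingNorm u) := by
  classical
  have h2 : 2 ∣ 2 ^ k := dvd_pow_self 2 (by omega)
  choose s hs hs' using hpart
  have hs0 : s 0 = 0 := (hs' 0 0 hzero).symm
  have hF : ∀ (X Y : ℂ) (x : ZMod (2 ^ k)),
      ∑ u, ZMod.stdAddChar (x * s u) * weightMonomial (X + Y) (X - Y) u
        = 2 ^ Fintype.card (Fin (2 ^ (k - 1))) * weightMonomial X Y (a x) := by
    intro X Y x
    rw [weightMonomial_eq, sum_mul_weightMonomial_of_eigenfunction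
      (fun u => ZMod.stdAddChar (x * s u)) (hammingNorm (a x)) ?_ X Y]
    · simp [hs0]
    · intro u
      rw [sum_class_neighbors hk h2 H hdist4 hparity s hs (fun i => ZMod.stdAddChar (x * i)),
        sum_stdAddChar_opposite_parity hk h2 a ha_zero ha_compl ha_dist, Fintype.card_fin]
  let S : Finset (Fin n × Fin (2 ^ (k - 1)) → ZMod 2) :=
    {u | ∀ x ∈ C, ∑ i, x i * s (fun j => u (i, j)) = 0}
  have hSmem : ∀ u, u ∈ S ↔ ∀ x ∈ C, ∑ i, x i * s (fun j => u (i, j)) = 0 :=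
    fun u => mem_filter_univ u
  have hS : {u : Fin n × Fin (2 ^ (k - 1)) → ZMod 2 |
      ∃ y : Fin n → ZMod (2 ^ k), (∀ x ∈ C, ∑ i, x i * y i = 0) ∧
        ∀ i, (fun j => u (i, j)) ∈ H (y i)} = S := by
    ext u
    rw [mem_coe, hSmem, Set.mem_ofPred_eq]
    constructor
    · rintro ⟨y, hy, huy⟩
      have h : y = fun i => s fun j => u (i, j) := funext fun i => hs' _ _ (huy i)
      rwa [h] at hy
    · exact fun h => ⟨_, h, fun i => hs _⟩
  have hmain := fun X Y : ℂ => sum_submodule_weightMonomial a s X Y (hF X Y) C S hSmem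
  have hinj : Function.Injective fun (x : Fin n → ZMod (2 ^ k))
      (p : Fin n × Fin (2 ^ (k - 1))) => a (x p.1) p.2 := fun x y hxy =>
    funext fun i => ha_inj (funext fun j => congrFun hxy (i, j))
  have hnorm : (2 ^ Fintype.card (Fin (2 ^ (k - 1))) : ℂ) ^ Fintype.card (Fin n)
      = Fintype.card C * #S := by
    have h := hmain 1 0
    have h1 : ∀ u : Fin n × Fin (2 ^ (k - 1)) → ZMod 2, weightMonomial 1 1 u = 1 := by
      simp [weightMonomial]
    have hz : ∀ x : C, (fun p : Fin n × Fin (2 ^ (k - 1)) => a (x.1 p.1) p.2) = 0 ↔ x = 0 := by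
      intro x
      have h0 : (fun p : Fin n × Fin (2 ^ (k - 1)) => a ((0 : Fin n → ZMod (2 ^ k)) p.1) p.2)
          = 0 := by
        simp [ha_zero, Pi.zero_def]
      rw [← h0, ← Subtype.coe_inj]
      exact hinj.eq_iff
    simpa [weightMonomial_one_zero, h1, hz] using h
  intro X Y
  have hC : (C : Set (Fin n → ZMod (2 ^ k)))
      = ((univ.filter (· ∈ C) : Finset (Fin n → ZMod (2 ^ k))) : Set _) := by
    ext x
    simp
  have hcast : ∀ (X Y : ℝ) (u : Fin n × Fin (2 ^ (k - 1)) → ZMod 2),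
      ((X ^ (n * 2 ^ (k - 1) - hammingNorm u) * Y ^ hammingNorm u : ℝ) : ℂ)
        = weightMonomial X Y u := by
    intro X Y u
    rw [weightMonomial_eq, Fintype.card_prod, Fintype.card_fin, Fintype.card_fin]
    push_cast
    rfl
  rw [hS, Set.ncard_coe_finset, finsum_mem_image hinj.injOn, finsum_mem_coe_finset, hC,
    finsum_mem_coe_finset]
  have hsub := sum_subtype (F := inferInstanceAs (Fintype C))
    (univ.filter (· ∈ C) : Finset (Fin n → ZMod (2 ^ k))) (fun x => mem_filter_univ x) (fun x =>
      weightMonomial X Y fun p : Fin n × Fin (2 ^ (k - 1)) => a (x p.1) p.2)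
  have h := hmain X Y
  have hne : (Fintype.card C * #S : ℂ) ≠ 0 :=
    hnorm ▸ pow_ne_zero _ (pow_ne_zero _ two_ne_zero)
  rw [hnorm, mul_assoc] at h
  have h3 := mul_left_cancel₀ (left_ne_zero_of_mul hne) h
  rw [eq_inv_mul_iff_mul_eq₀ (by exact_mod_cast right_ne_zero_of_mul hne)]
  apply Complex.ofReal_injective
  simp only [Complex.ofReal_mul, Complex.ofReal_sum, Complex.ofReal_natCast]
  simp only [← Complex.ofReal_mul, hcast, hsub]
  simpa using h3
end

section
/- A linear code H ⊆ Z_{2^k}^n is an (n, n·2^k, n·2^{k-2})* code (cardinality n·2^k and minimum d*-distance n·2^{k-2}) if and only if its dual H^⊥ is a 1'-perfect code in (Z_{2^k}^n, d^◇), i.e., |H^⊥| = 2^{kn}/(n·2^k), the minimum d^◇-distance of H^⊥ is at least 4, and every word of odd coordinate sum is at d^◇-distance 1 from exactly one codeword of H^⊥. -/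
/-- `wt*` on `Z_{2^k}`: `wt*(0)=0`, `wt*(2^{k-1})=2^{k-1}`, `wt*(x)=2^{k-2}` otherwise. -/
def wtStarK (k : ℕ) (x : ZMod (2 ^ k)) : ℕ :=
  if x = 0 then 0 else if x = (2 ^ (k - 1) : ZMod (2 ^ k)) then 2 ^ (k - 1) else 2 ^ (k - 2)

/-- The induced distance `d*` on `Z_{2^k}^n`. -/
def dStarK (k n : ℕ) (x y : Fin n → ZMod (2 ^ k)) : ℕ :=
  ∑ i, wtStarK k (y i - x i)

/-- The weight `wt^◇`. -/
def wtDia {M : ℕ} (x : ZMod M) : ℕ :=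
  if x = 0 then 0 else if Odd x.val then 1 else 2

/-- The induced distance `d^◇`. -/
def dDia {M : ℕ} (n : ℕ) (x y : Fin n → ZMod M) : ℕ :=
  ∑ i, wtDia (y i - x i)

/-- The dual code with respect to the standard bilinear form. -/
def dualCode {R ι : Type*} [CommRing R] [Fintype ι] (H : Submodule R (ι → R)) :
    Submodule R (ι → R) where
  carrier := {y | ∀ x ∈ H, ∑ i, x i * y i = 0}
  add_mem' {a b} ha hb x hx := by
    simp only [Pi.add_apply, mul_add, Finset.sum_add_distrib, ha x hx, hb x hx, add_zero]
  zero_mem' x _ := by simp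
  smul_mem' c y hy x hx := by
    simp only [Pi.smul_apply, smul_eq_mul, mul_left_comm _ c, ← Finset.mul_sum, hy x hx, mul_zero]

theorem mem_dualCode {R ι : Type*} [CommRing R] [Fintype ι] {H : Submodule R (ι → R)}
    {y : ι → R} : y ∈ dualCode H ↔ ∀ x ∈ H, x ⬝ᵥ y = 0 := Iff.rfl

theorem stdAddChar_eq_one_iff {N : ℕ} [NeZero N] {x : ZMod N} :
    ZMod.stdAddChar x = 1 ↔ x = 0 := by
  rw [← AddChar.map_zero_eq_one (ZMod.stdAddChar (N := N))]
  exact ZMod.injective_stdAddChar.eq_iff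

theorem sum_stdAddChar_hom_eq_zero {N : ℕ} [NeZero N] {G : Type*} [AddCommGroup G] [Fintype G]
    (f : G →+ ZMod N) {g : G} (hg : f g ≠ 0) : ∑ x, ZMod.stdAddChar (f x) = 0 := by
  refine (AddChar.sum_eq_zero_iff_ne_zero (ψ := ZMod.stdAddChar.compAddMonoidHom f)).2 fun h => ?_
  have h' : (ZMod.stdAddChar.compAddMonoidHom f) g = 1 := by rw [h, AddChar.zero_apply]
  exact hg (stdAddChar_eq_one_iff.1 h')

theorem sum_stdAddChar_dotProduct {N : ℕ} [NeZero N] {ι : Type*} [Fintype ι]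
    (H : Submodule (ZMod N) (ι → ZMod N)) [Fintype H] (y : ι → ZMod N)
    [Decidable (y ∈ dualCode H)] :
    ∑ x : H, ZMod.stdAddChar ((x : ι → ZMod N) ⬝ᵥ y) =
      if y ∈ dualCode H then (Fintype.card H : ℂ) else 0 := by
  classical
  split_ifs with hy
  · rw [Finset.sum_congr rfl fun x _ => by rw [mem_dualCode.1 hy x x.2, AddChar.map_zero_eq_one]]
    simp
  · let f : H →+ ZMod N :=
      { toFun := fun x => (x : ι → ZMod N) ⬝ᵥ y
        map_zero' := by simp
        map_add' := fun a b => by simp [add_dotProduct] }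
    obtain ⟨x, hx, hxy⟩ : ∃ x ∈ H, x ⬝ᵥ y ≠ 0 := by
      simpa [mem_dualCode] using hy
    exact sum_stdAddChar_hom_eq_zero f (g := ⟨x, hx⟩) hxy

theorem card_mul_card_dualCode {N : ℕ} [NeZero N] {ι : Type*} [Fintype ι]
    (H : Submodule (ZMod N) (ι → ZMod N)) :
    Nat.card H * Nat.card (dualCode H) = N ^ Fintype.card ι := by
  classical
  have h1 : ∑ y : ι → ZMod N, ∑ x : H, ZMod.stdAddChar ((x : ι → ZMod N) ⬝ᵥ y) =
      (Nat.card H * Nat.card (dualCode H) : ℂ) := by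
    simp only [sum_stdAddChar_dotProduct]
    rw [← Finset.sum_filter, Finset.sum_const, nsmul_eq_mul, mul_comm, Nat.card_eq_fintype_card,
      Nat.card_eq_fintype_card, Fintype.card_subtype (· ∈ dualCode H)]
  have h2 : ∀ x : H, ∑ y : ι → ZMod N, ZMod.stdAddChar ((x : ι → ZMod N) ⬝ᵥ y) =
      if x = 0 then (N ^ Fintype.card ι : ℂ) else 0 := by
    intro x
    split_ifs with hx
    · simp [hx]
    · let f : (ι → ZMod N) →+ ZMod N :=
        { toFun := fun y => (x : ι → ZMod N) ⬝ᵥ y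
          map_zero' := by simp
          map_add' := fun a b => by simp [dotProduct_add] }
      obtain ⟨i, hi⟩ : ∃ i, (x : ι → ZMod N) i ≠ 0 := by
        by_contra! h
        exact hx (Subtype.ext (funext h))
      exact sum_stdAddChar_hom_eq_zero f (g := Pi.single i 1) (by simpa [f] using hi)
  rw [Finset.sum_comm, Finset.sum_congr rfl fun x _ => h2 x] at h1
  rw [Finset.sum_ite_eq' Finset.univ] at h1
  simp only [Finset.mem_univ, if_true] at h1
  exact_mod_cast h1.symm

theorem zmod_two_ne_one_iff {a : ZMod 2} : a ≠ 1 ↔ a = 0 := by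
  revert a; decide

theorem two_mul_card_fiber_one {G : Type*} [AddCommGroup G] [Finite G] (f : G →+ ZMod 2)
    {g : G} (hg : f g = 1) : 2 * Nat.card {x // f x = 1} = Nat.card G := by
  have e : {x // ¬ f x = 1} ≃ {x // f x = 1} :=
    (Equiv.addRight g).subtypeEquiv fun x => by
      simp [hg, zmod_two_ne_one_iff]
  rw [← Nat.card_congr (Equiv.sumCompl fun x => f x = 1), Nat.card_sum, Nat.card_congr e, two_mul]

theorem sum_fiber_one_eq_zero {G : Type*} [AddCommGroup G] [Fintype G] (f : G →+ ZMod 2)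
    (ψ : AddChar G ℂ) {g : G} (hg : f g = 0) (hψ : ψ g ≠ 1) :
    ∑ x : {x // f x = 1}, ψ x = 0 := by
  let e : {x // f x = 1} ≃ {x // f x = 1} :=
    (Equiv.addRight g).subtypeEquiv fun x => by simp [hg]
  have h := Equiv.sum_comp e fun x => ψ x
  have h' : ∀ x, ψ (e x) = ψ x * ψ g := fun x => AddChar.map_add_eq_mul ψ x g
  simp only [h', ← Finset.sum_mul] at h
  by_contra hne
  exact hψ (mul_left_cancel₀ hne (by rw [h, mul_one]))

section Parity

variable {k : ℕ} (π : ZMod (2 ^ k) →+* ZMod 2)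

theorem parity_eq_val (x : ZMod (2 ^ k)) : π x = (x.val : ZMod 2) := by
  conv_lhs => rw [← ZMod.natCast_zmod_val x]
  exact map_natCast π _

theorem one_le_of_parity {k : ℕ} (π : ZMod (2 ^ k) →+* ZMod 2) : 1 ≤ k := by
  rcases Nat.eq_zero_or_pos k with rfl | h
  · have : (1 : ZMod (2 ^ 0)) = 0 := Subsingleton.elim (α := ZMod 1) _ _
    have := congrArg π this
    simp at this
  · exact h

theorem half_mul_two {k : ℕ} (hk : 1 ≤ k) : (2 ^ (k - 1) * 2 : ZMod (2 ^ k)) = 0 := by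
  rw [← pow_succ, Nat.sub_add_cancel hk]
  exact_mod_cast ZMod.natCast_self (2 ^ k)

theorem half_ne_zero {k : ℕ} (hk : 1 ≤ k) : (2 ^ (k - 1) : ZMod (2 ^ k)) ≠ 0 := by
  intro h
  have h' : ((2 ^ (k - 1) : ℕ) : ZMod (2 ^ k)) = 0 := by exact_mod_cast h
  rw [ZMod.natCast_eq_zero_iff, Nat.pow_dvd_pow_iff_le_right'] at h'
  omega

theorem eq_zero_or_eq_half {k : ℕ} (hk : 1 ≤ k) {x : ZMod (2 ^ k)} (hx : x * 2 = 0) :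
    x = 0 ∨ x = 2 ^ (k - 1) := by
  have h : ((x.val * 2 : ℕ) : ZMod (2 ^ k)) = 0 := by push_cast; simpa using hx
  have e : 2 ^ k = 2 ^ (k - 1) * 2 := by rw [← pow_succ, Nat.sub_add_cancel hk]
  have hlt : x.val < 2 ^ (k - 1) * 2 := (ZMod.val_lt x).trans_eq e
  have hdvd : 2 ^ (k - 1) * 2 ∣ x.val * 2 := by
    refine e.symm.dvd.trans ?_
    rwa [← ZMod.natCast_eq_zero_iff]
  obtain ⟨c, hc⟩ := Nat.dvd_of_mul_dvd_mul_right two_pos hdvd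
  rw [hc] at hlt
  have hc2 : c < 2 := Nat.lt_of_mul_lt_mul_left hlt
  rw [← ZMod.natCast_zmod_val x, hc]
  interval_cases c <;> simp

theorem mul_half_of_even {a : ZMod (2 ^ k)} (ha : π a = 0) : a * 2 ^ (k - 1) = 0 := by
  rw [parity_eq_val, ZMod.natCast_eq_zero_iff_even] at ha
  obtain ⟨c, hc⟩ := ha
  rw [← ZMod.natCast_zmod_val a, hc, Nat.cast_add, ← two_mul, mul_right_comm, mul_comm 2,
    half_mul_two (one_le_of_parity π), zero_mul]

theorem mul_half_of_odd {a : ZMod (2 ^ k)} (ha : π a = 1) : a * 2 ^ (k - 1) = 2 ^ (k - 1) := by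
  have := mul_half_of_even π (a := a - 1) (by simp [ha])
  rwa [sub_mul, one_mul, sub_eq_zero] at this

theorem stdAddChar_half (hk : 1 ≤ k) : ZMod.stdAddChar (2 ^ (k - 1) : ZMod (2 ^ k)) = -1 := by
  have h : ZMod.stdAddChar (2 ^ (k - 1) : ZMod (2 ^ k)) *
      ZMod.stdAddChar (2 ^ (k - 1) : ZMod (2 ^ k)) = 1 := by
    rw [← AddChar.map_add_eq_mul, ← mul_two, half_mul_two hk, AddChar.map_zero_eq_one]
  exact (mul_self_eq_one_iff.1 h).resolve_left fun h => half_ne_zero hk (stdAddChar_eq_one_iff.1 h)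

/-- The normalised sum of `x` over the characters with odd index:
`1` at `0`, `-1` at `2 ^ (k - 1)` and `0` elsewhere. -/
noncomputable def signK (k : ℕ) (x : ZMod (2 ^ k)) : ℝ :=
  if x = 0 then 1 else if x = 2 ^ (k - 1) then -1 else 0

theorem card_odd : (Nat.card {a : ZMod (2 ^ k) // π a = 1}) = 2 ^ (k - 1) := by
  have h := two_mul_card_fiber_one π.toAddMonoidHom (g := 1) (by simp)
  rw [Nat.card_zmod] at h
  have e : 2 ^ k = 2 * 2 ^ (k - 1) := by
    rw [← pow_succ', Nat.sub_add_cancel (one_le_of_parity π)]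
  exact Nat.eq_of_mul_eq_mul_left two_pos (h.trans e)

theorem sum_odd_stdAddChar (x : ZMod (2 ^ k)) :
    ∑ a : {a : ZMod (2 ^ k) // π a = 1}, ZMod.stdAddChar (x * (a : ZMod (2 ^ k))) =
      (2 ^ (k - 1) * signK k x : ℂ) := by
  have hk := one_le_of_parity π
  have hc : (Fintype.card {a : ZMod (2 ^ k) // π a = 1} : ℂ) = 2 ^ (k - 1) := by
    rw [← Nat.card_eq_fintype_card, card_odd]; simp
  unfold signK
  split_ifs with h0 h1
  · simp [h0, hc]
  · subst h1
    have : ∀ a : {a : ZMod (2 ^ k) // π a = 1},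
        ZMod.stdAddChar (2 ^ (k - 1) * (a : ZMod (2 ^ k))) = -1 := fun a => by
      rw [mul_comm, mul_half_of_odd π a.2, stdAddChar_half hk]
    simp [this, hc]
  · have h2 : ZMod.stdAddChar (x * 2) ≠ 1 := fun h => by
      rcases eq_zero_or_eq_half hk (stdAddChar_eq_one_iff.1 h) with h | h
      exacts [h0 h, h1 h]
    have hπ : π 2 = 0 := by rw [map_ofNat]; rfl
    have := sum_fiber_one_eq_zero π.toAddMonoidHom
      (ZMod.stdAddChar.compAddMonoidHom (AddMonoidHom.mulLeft x)) (g := 2) hπ h2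
    simp only [Complex.ofReal_zero, mul_zero]
    exact this

/-- Sum of `signK` over the coordinates. -/
noncomputable def signSum (k : ℕ) {ι : Type*} [Fintype ι] (x : ι → ZMod (2 ^ k)) : ℝ :=
  ∑ i, signK k (x i)

/-- Vectors with exactly one nonzero coordinate, which is odd. -/
abbrev OddSingle (ι : Type*) := ι × {a : ZMod (2 ^ k) // π a = 1}

variable {ι : Type*} [DecidableEq ι]

/-- The vector described by an `OddSingle`. -/
def OddSingle.vec {π : ZMod (2 ^ k) →+* ZMod 2} (t : OddSingle π ι) : ι → ZMod (2 ^ k) :=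
  Pi.single t.1 (t.2 : ZMod (2 ^ k))

theorem OddSingle.vec_injective : Function.Injective (OddSingle.vec (π := π) (ι := ι)) := by
  rintro ⟨i, a, ha⟩ ⟨j, b, hb⟩ h
  have ne : ∀ {a}, π a = 1 → a ≠ 0 := fun h h0 => by simp [h0] at h
  have hi := congrFun h i
  have hij : i = j := by
    by_contra hij
    simp [OddSingle.vec, Pi.single_eq_of_ne hij] at hi
    exact ne ha hi
  subst hij
  simpa [OddSingle.vec] using hi

variable [Fintype ι]

theorem sum_oddSingle (x : ι → ZMod (2 ^ k)) :
    ∑ t : OddSingle π ι, ZMod.stdAddChar (x ⬝ᵥ t.vec) = (2 ^ (k - 1) * signSum k x : ℂ) := by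
  rw [Fintype.sum_prod_type]
  simp only [OddSingle.vec, dotProduct_single, sum_odd_stdAddChar]
  rw [signSum, Complex.ofReal_sum, Finset.mul_sum]

omit [DecidableEq ι] in
theorem card_oddSingle : Nat.card (OddSingle π ι) = Fintype.card ι * 2 ^ (k - 1) := by
  rw [Nat.card_prod, card_odd, Nat.card_eq_fintype_card]

theorem parity_sum_vec (t : OddSingle π ι) : π (∑ i, t.vec i) = 1 := by
  simp [OddSingle.vec, t.2.2]

theorem sum_signSum_mul (H : Submodule (ZMod (2 ^ k)) (ι → ZMod (2 ^ k))) [Fintype H]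
    [DecidablePred (· ∈ dualCode H)]
    (hH : Fintype.card H = Fintype.card ι * 2 ^ k) (w : ι → ZMod (2 ^ k)) :
    ∑ x : H, signSum k (x : ι → ZMod (2 ^ k)) *
        (ZMod.stdAddChar (-((x : ι → ZMod (2 ^ k)) ⬝ᵥ w))).re =
      2 * Fintype.card ι *
        (Finset.univ.filter fun t : OddSingle π ι => t.vec - w ∈ dualCode H).card := by
  have h : ∑ x : H, (2 ^ (k - 1) * signSum k (x : ι → ZMod (2 ^ k)) : ℂ) *
      ZMod.stdAddChar (-((x : ι → ZMod (2 ^ k)) ⬝ᵥ w)) =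
      (Fintype.card H : ℂ) *
        (Finset.univ.filter fun t : OddSingle π ι => t.vec - w ∈ dualCode H).card := by
    simp only [← sum_oddSingle π, Finset.sum_mul]
    rw [Finset.sum_comm]
    simp only [← AddChar.map_add_eq_mul, ← sub_eq_add_neg, ← dotProduct_sub,
      sum_stdAddChar_dotProduct]
    rw [← Finset.sum_filter, Finset.sum_const, nsmul_eq_mul, mul_comm]
  have h' := congrArg Complex.re h
  have e : (2 : ℝ) ^ k = 2 ^ (k - 1) * 2 := by
    rw [← pow_succ, Nat.sub_add_cancel (one_le_of_parity π)]
  have hp : (2 : ℝ) ^ (k - 1) ≠ 0 := by positivity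
  rw [hH, Complex.re_sum] at h'
  have hs : ∀ x : H, ((2 ^ (k - 1) * signSum k (x : ι → ZMod (2 ^ k)) : ℂ) *
      ZMod.stdAddChar (-((x : ι → ZMod (2 ^ k)) ⬝ᵥ w))).re = 2 ^ (k - 1) *
      (signSum k (x : ι → ZMod (2 ^ k)) *
        (ZMod.stdAddChar (-((x : ι → ZMod (2 ^ k)) ⬝ᵥ w))).re) := fun x => by
    rw [← Complex.ofReal_ofNat, ← Complex.ofReal_pow, ← Complex.ofReal_mul, Complex.re_ofReal_mul,
      mul_assoc]
  rw [Finset.sum_congr rfl fun x _ => hs x, ← Finset.mul_sum] at h'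
  apply mul_left_cancel₀ hp
  rw [h']
  rw [← Complex.ofReal_natCast, ← Complex.ofReal_natCast, ← Complex.ofReal_mul, Complex.ofReal_re]
  push_cast
  rw [e]
  ring

omit [DecidableEq ι] in
theorem signSum_zero : signSum k (0 : ι → ZMod (2 ^ k)) = Fintype.card ι := by
  simp [signSum, signK]

theorem oddSingle_separated_and_half_mem [Nonempty ι]
    (H : Submodule (ZMod (2 ^ k)) (ι → ZMod (2 ^ k)))
    (hH : Nat.card H = Fintype.card ι * 2 ^ k) (hF : ∀ x ∈ H, x ≠ 0 → signSum k x ≤ 0) :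
    (∀ t t' : OddSingle π ι, t.vec - t'.vec ∈ dualCode H → t = t') ∧
      (fun _ => 2 ^ (k - 1)) ∈ H := by
  classical
  rw [Nat.card_eq_fintype_card] at hH
  have key := sum_signSum_mul π H hH
  have hk := one_le_of_parity π
  have hn : (0 : ℝ) < Fintype.card ι := by exact_mod_cast Fintype.card_pos
  have hite : ∀ a : ℝ, ∑ x : H, (if x = 0 then a else 0) = a := fun a => by simp
  have hle : ∀ x : H, x ≠ 0 → signSum k (x : ι → ZMod (2 ^ k)) ≤ 0 := fun x hx =>
    hF x x.2 fun h => hx (Subtype.ext h)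
  have hS : ∑ x : H, signSum k (x : ι → ZMod (2 ^ k)) = 0 := by
    have h0 := key 0
    simp only [dotProduct_zero, neg_zero, AddChar.map_zero_eq_one, Complex.one_re, mul_one] at h0
    have hub : ∑ x : H, signSum k (x : ι → ZMod (2 ^ k)) ≤ Fintype.card ι := by
      rw [← hite (Fintype.card ι)]
      refine Finset.sum_le_sum fun x _ => ?_
      split_ifs with hx
      · rw [hx]; exact signSum_zero.le
      · exact hle x hx
    rw [h0] at hub ⊢
    set c := (Finset.univ.filter fun t : OddSingle π ι => t.vec - 0 ∈ dualCode H).card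
    have : c = 0 := by
      by_contra hc
      have : (1 : ℝ) ≤ c := by exact_mod_cast Nat.one_le_iff_ne_zero.2 hc
      nlinarith
    rw [this]; simp
  have habs : ∑ x : H, |signSum k (x : ι → ZMod (2 ^ k))| = 2 * Fintype.card ι := by
    have : ∀ x : H, |signSum k (x : ι → ZMod (2 ^ k))| =
        (if x = 0 then (2 * Fintype.card ι : ℝ) else 0) - signSum k (x : ι → ZMod (2 ^ k)) := by
      intro x
      split_ifs with hx
      · rw [hx, ZeroMemClass.coe_zero, signSum_zero, abs_of_pos hn]; ring
      · rw [abs_of_nonpos (hle x hx), zero_sub]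
    rw [Finset.sum_congr rfl fun x _ => this x, Finset.sum_sub_distrib, hite, hS, sub_zero]
  have hterm : ∀ (w : ι → ZMod (2 ^ k)) (x : H), signSum k (x : ι → ZMod (2 ^ k)) *
      (ZMod.stdAddChar (-((x : ι → ZMod (2 ^ k)) ⬝ᵥ w))).re ≤
        |signSum k (x : ι → ZMod (2 ^ k))| := by
    intro w x
    have h1 : |(ZMod.stdAddChar (-((x : ι → ZMod (2 ^ k)) ⬝ᵥ w))).re| ≤ 1 :=
      (Complex.abs_re_le_norm _).trans_eq (AddChar.norm_apply _ _)
    refine (le_abs_self _).trans ?_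
    rw [abs_mul]
    exact mul_le_of_le_one_right (abs_nonneg _) h1
  have hcard : ∀ w : ι → ZMod (2 ^ k),
      (Finset.univ.filter fun t : OddSingle π ι => t.vec - w ∈ dualCode H).card ≤ 1 := by
    intro w
    have h := (key w).symm.trans_le ((Finset.sum_le_sum fun x _ => hterm w x).trans_eq habs)
    by_contra! hc
    have hc' : (2 : ℝ) ≤
      (Finset.univ.filter fun t : OddSingle π ι => t.vec - w ∈ dualCode H).card := by
      exact_mod_cast hc
    nlinarith
  refine ⟨fun t t' h => Finset.card_le_one.1 (hcard t'.vec) t (by simpa using h) t'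
    (by simp), ?_⟩
  obtain ⟨x, hx⟩ : ∃ x : H, signSum k (x : ι → ZMod (2 ^ k)) < 0 := by
    by_contra! h
    have := (Finset.sum_eq_zero_iff_of_nonneg fun x _ => h x).1 hS 0 (Finset.mem_univ _)
    rw [ZeroMemClass.coe_zero, signSum_zero] at this
    exact hn.ne' this
  convert x.2 using 1
  funext i
  let t : OddSingle π ι := (i, ⟨1, map_one π⟩)
  have hc1 : (Finset.univ.filter fun s : OddSingle π ι => s.vec - t.vec ∈ dualCode H).card = 1 :=
    le_antisymm (hcard _) (Finset.card_pos.2 ⟨t, by simp⟩)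
  have heq := key t.vec
  rw [hc1, Nat.cast_one, mul_one, ← habs] at heq
  have hx' := (Finset.sum_eq_sum_iff_of_le fun x _ => hterm t.vec x).1 heq x (Finset.mem_univ _)
  rw [abs_of_neg hx] at hx'
  have hre : (ZMod.stdAddChar (-((x : ι → ZMod (2 ^ k)) ⬝ᵥ t.vec))).re = -1 :=
    mul_right_cancel₀ hx.ne (by rw [mul_comm, hx', neg_one_mul])
  have hdot : (x : ι → ZMod (2 ^ k)) ⬝ᵥ t.vec = (x : ι → ZMod (2 ^ k)) i :=
    dotProduct_single_one _ _
  rw [hdot] at hre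
  have hnorm := AddChar.norm_apply (ZMod.stdAddChar (N := 2 ^ k)) (-(x : ι → ZMod (2 ^ k)) i)
  have hval : ZMod.stdAddChar (-(x : ι → ZMod (2 ^ k)) i) = -1 := by
    have h2 := Complex.sq_norm (ZMod.stdAddChar (-(x : ι → ZMod (2 ^ k)) i))
    rw [hnorm, Complex.normSq_apply, hre] at h2
    apply Complex.ext
    · simpa using hre
    · simp only [Complex.neg_im, Complex.one_im, neg_zero]
      nlinarith
  rw [← stdAddChar_half hk] at hval
  have := ZMod.injective_stdAddChar hval
  rw [neg_eq_iff_eq_neg] at this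
  rw [this, eq_neg_iff_add_eq_zero, ← mul_two, half_mul_two hk]

omit [DecidableEq ι] in
theorem parity_sum_eq_zero_of_half_mem {H : Submodule (ZMod (2 ^ k)) (ι → ZMod (2 ^ k))}
    (hH : (fun _ => 2 ^ (k - 1)) ∈ H) {c : ι → ZMod (2 ^ k)} (hc : c ∈ dualCode H) :
    π (∑ i, c i) = 0 := by
  have h : (∑ i, c i) * 2 ^ (k - 1) = 0 := by
    rw [Finset.sum_mul]
    simpa [dotProduct, mul_comm] using mem_dualCode.1 hc _ hH
  by_contra h1
  rw [mul_half_of_odd π (by_contra fun h2 => h1 (zmod_two_ne_one_iff.1 h2))] at h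
  exact half_ne_zero (one_le_of_parity π) h

/-- The homomorphism taking a word to the parity of its coordinate sum. -/
def paritySum (ι : Type*) [Fintype ι] : (ι → ZMod (2 ^ k)) →+ ZMod 2 where
  toFun z := π (∑ i, z i)
  map_zero' := by simp
  map_add' a b := by simp [Finset.sum_add_distrib]

/-- Translating an even dual codeword by an `OddSingle` gives an odd word. -/
def oddTranslate {H : Submodule (ZMod (2 ^ k)) (ι → ZMod (2 ^ k))}
    (heven : ∀ c ∈ dualCode H, paritySum π ι c = 0) (p : dualCode H × OddSingle π ι) :
    {z // paritySum π ι z = 1} :=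
  ⟨p.1 + p.2.vec, by
    rw [map_add, heven _ p.1.2, zero_add]; exact parity_sum_vec π p.2⟩

theorem oddTranslate_bijective [Nonempty ι] {H : Submodule (ZMod (2 ^ k)) (ι → ZMod (2 ^ k))}
    (hH : Nat.card H = Fintype.card ι * 2 ^ k)
    (heven : ∀ c ∈ dualCode H, paritySum π ι c = 0)
    (hsep : ∀ t t' : OddSingle π ι, t.vec - t'.vec ∈ dualCode H → t = t') :
    Function.Bijective (oddTranslate π heven) := by
  rw [Nat.bijective_iff_injective_and_card]
  constructor
  · rintro ⟨⟨c, hc⟩, t⟩ ⟨⟨c', hc'⟩, t'⟩ h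
    have h' : c + t.vec = c' + t'.vec := congrArg Subtype.val h
    have : t = t' := hsep t t' (by
      have : t.vec - t'.vec = c' - c := by
        rw [sub_eq_sub_iff_add_eq_add, add_comm, h']
      rw [this]
      exact sub_mem hc' hc)
    subst this
    simpa using h'
  · obtain ⟨i⟩ := ‹Nonempty ι›
    have h2 := two_mul_card_fiber_one (paritySum π ι) (g := Pi.single i 1)
      (parity_sum_vec π (i, ⟨1, map_one π⟩))
    have h3 := card_mul_card_dualCode H
    rw [Nat.card_fun, Nat.card_zmod, Nat.card_eq_fintype_card (α := ι), ← h3, hH] at h2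
    have e : 2 ^ k = 2 * 2 ^ (k - 1) := by
      rw [← pow_succ', Nat.sub_add_cancel (one_le_of_parity π)]
    apply Nat.eq_of_mul_eq_mul_left two_pos
    rw [h2, Nat.card_prod, card_oddSingle]
    generalize Nat.card (dualCode H) = d
    rw [e]
    ring

theorem signSum_nonpos_of_oddTranslate_bijective
    {H : Submodule (ZMod (2 ^ k)) (ι → ZMod (2 ^ k))}
    (heven : ∀ c ∈ dualCode H, paritySum π ι c = 0)
    (hbij : Function.Bijective (oddTranslate π heven)) {x : ι → ZMod (2 ^ k)} (hx : x ∈ H)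
    (hx0 : x ≠ 0) : signSum k x ≤ 0 := by
  classical
  have hk := one_le_of_parity π
  by_cases hconst : ∀ i, x i = 2 ^ (k - 1)
  · refine Finset.sum_nonpos fun i _ => ?_
    simp [signK, hconst, half_ne_zero hk]
  let f : (ι → ZMod (2 ^ k)) →+ ZMod (2 ^ k) :=
    { toFun := fun y => x ⬝ᵥ y
      map_zero' := by simp
      map_add' := fun a b => by simp [dotProduct_add] }
  obtain ⟨g, hg, hg'⟩ : ∃ g, paritySum π ι g = 0 ∧ f g ≠ 0 := by
    by_contra! h
    have hdouble : ∀ i, x i * 2 = 0 := fun i => by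
      have := h (Pi.single i 2) (by
        simp only [paritySum, AddMonoidHom.coe_mk, ZeroHom.coe_mk, Finset.sum_pi_single',
          Finset.mem_univ, if_true, map_ofNat]
        rfl)
      simpa [f] using this
    have hsingle : ∀ i, paritySum π ι (Pi.single i 1) = 1 := fun i =>
      parity_sum_vec π (i, ⟨1, map_one π⟩)
    have hsame : ∀ i j, x i = x j := fun i j => by
      have := h (Pi.single i 1 - Pi.single j 1) (by
        rw [map_sub, hsingle, hsingle, sub_self])
      simpa [f, dotProduct_sub, sub_eq_zero] using this
    push Not at hconst
    obtain ⟨i, hi⟩ := hconst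
    have hi0 := (eq_zero_or_eq_half hk (hdouble i)).resolve_right hi
    exact hx0 (funext fun j => (hsame j i).trans hi0)
  have hzero := sum_fiber_one_eq_zero (paritySum π ι) (ZMod.stdAddChar.compAddMonoidHom f) hg
    (fun h => hg' (stdAddChar_eq_one_iff.1 h))
  rw [← hbij.sum_comp, Fintype.sum_prod_type] at hzero
  have hval : ∀ (c : dualCode H) (t : OddSingle π ι),
      ZMod.stdAddChar.compAddMonoidHom f (oddTranslate π heven (c, t) : ι → ZMod (2 ^ k)) =
        ZMod.stdAddChar (x ⬝ᵥ t.vec) := fun c t => by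
    change ZMod.stdAddChar (x ⬝ᵥ ((c : ι → ZMod (2 ^ k)) + t.vec)) = _
    rw [dotProduct_add, mem_dualCode.1 c.2 x hx, zero_add]
  simp only [hval, sum_oddSingle] at hzero
  rw [Finset.sum_const, nsmul_eq_mul] at hzero
  have hcard : ((Finset.univ : Finset (dualCode H)).card : ℂ) ≠ 0 := by
    exact_mod_cast (Finset.card_pos.2 ⟨0, Finset.mem_univ _⟩).ne'
  have := (mul_eq_zero.1 ((mul_eq_zero.1 hzero).resolve_left hcard)).resolve_left
    (pow_ne_zero _ two_ne_zero)
  exact (Complex.ofReal_eq_zero.1 this).le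

theorem wtStarK_eq (hk : 2 ≤ k) (x : ZMod (2 ^ k)) :
    (wtStarK k x : ℝ) = 2 ^ (k - 2) * (1 - signK k x) := by
  have e : 2 ^ (k - 1) = 2 ^ (k - 2) * 2 := by
    rw [← pow_succ]; congr 1; omega
  unfold wtStarK signK
  split_ifs
  · simp
  · rw [e]; push_cast; ring
  · simp

omit [DecidableEq ι] in
theorem le_sum_wtStarK_iff (hk : 2 ≤ k) (x : ι → ZMod (2 ^ k)) :
    Fintype.card ι * 2 ^ (k - 2) ≤ ∑ i, wtStarK k (x i) ↔ signSum k x ≤ 0 := by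
  rw [← Nat.cast_le (α := ℝ)]
  push_cast
  simp only [wtStarK_eq hk]
  rw [← Finset.mul_sum, mul_comm, mul_le_mul_iff_right₀ (by positivity), Finset.sum_sub_distrib,
    signSum]
  simp

theorem natCast_wtDia (x : ZMod (2 ^ k)) : (wtDia x : ZMod 2) = π x := by
  unfold wtDia
  split_ifs with h0 h1
  · simp [h0]
  · rw [parity_eq_val, ZMod.natCast_eq_one_iff_odd.2 h1, Nat.cast_one]
  · rw [parity_eq_val, ZMod.natCast_eq_zero_iff_even.2 (Nat.not_odd_iff_even.1 h1)]
    rfl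

theorem wtDia_eq_one_iff (x : ZMod (2 ^ k)) : wtDia x = 1 ↔ π x = 1 := by
  rw [← natCast_wtDia]
  unfold wtDia
  split_ifs <;> decide

theorem wtDia_eq_zero_iff (x : ZMod (2 ^ k)) : wtDia x = 0 ↔ x = 0 := by
  unfold wtDia
  split_ifs <;> simp_all

omit [DecidableEq ι] in
theorem natCast_sum_wtDia (x : ι → ZMod (2 ^ k)) :
    ((∑ i, wtDia (x i) : ℕ) : ZMod 2) = paritySum π ι x := by
  simp [natCast_wtDia π, paritySum]

theorem sum_wtDia_eq_one_iff (x : ι → ZMod (2 ^ k)) :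
    ∑ i, wtDia (x i) = 1 ↔ ∃ t : OddSingle π ι, x = t.vec := by
  constructor
  · intro h
    obtain ⟨i, -, hi⟩ : ∃ i ∈ Finset.univ, wtDia (x i) ≠ 0 :=
      Finset.exists_ne_zero_of_sum_ne_zero (by rw [h]; exact one_ne_zero)
    rw [← Finset.add_sum_erase _ _ (Finset.mem_univ i)] at h
    have h1 : wtDia (x i) = 1 := by omega
    have h2 : ∑ j ∈ Finset.univ.erase i, wtDia (x j) = 0 := by omega
    refine ⟨(i, ⟨x i, (wtDia_eq_one_iff π _).1 h1⟩), funext fun j => ?_⟩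
    by_cases hj : j = i
    · subst hj; simp [OddSingle.vec]
    · rw [Finset.sum_eq_zero_iff] at h2
      simpa [OddSingle.vec, hj] using (wtDia_eq_zero_iff _).1
        (h2 j (Finset.mem_erase.2 ⟨hj, Finset.mem_univ _⟩))
  · rintro ⟨t, rfl⟩
    rw [Finset.sum_eq_single t.1]
    · simpa [OddSingle.vec, wtDia_eq_one_iff π] using t.2.2
    · intro j _ hj
      simp [OddSingle.vec, hj, wtDia_eq_zero_iff]
    · simp

omit [Fintype ι] in
theorem OddSingle.exists_vec_eq_neg (t : OddSingle π ι) : ∃ t' : OddSingle π ι, t'.vec = -t.vec :=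
  ⟨(t.1, ⟨-t.2, by rw [map_neg, t.2.2]; rfl⟩), by simp [OddSingle.vec, Pi.single_neg]⟩

theorem sum_wtDia_sub_eq_one_iff (z c : ι → ZMod (2 ^ k)) :
    ∑ i, wtDia (c i - z i) = 1 ↔ ∃ t : OddSingle π ι, c + t.vec = z := by
  refine (sum_wtDia_eq_one_iff π (c - z)).trans ⟨?_, ?_⟩
  · rintro ⟨t, ht⟩
    obtain ⟨t', ht'⟩ := t.exists_vec_eq_neg
    exact ⟨t', by rw [ht', ← ht]; abel⟩
  · rintro ⟨t, rfl⟩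
    obtain ⟨t', ht'⟩ := t.exists_vec_eq_neg
    exact ⟨t', by rw [ht', sub_add_cancel_left]⟩

/-- A nonzero even word of weight at most `3` is a difference of two distinct `OddSingle`s. -/
theorem exists_sub_of_sum_wtDia_lt {c : ι → ZMod (2 ^ k)} (hc : paritySum π ι c = 0)
    (hc0 : c ≠ 0) (hlt : ∑ i, wtDia (c i) < 4) :
    ∃ t t' : OddSingle π ι, c = t.vec - t'.vec := by
  obtain ⟨i, hi⟩ := Function.ne_iff.1 hc0
  obtain ⟨b, hb, hw⟩ : ∃ b, π b = 1 ∧ wtDia (c i - b) + 1 = wtDia (c i) := by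
    by_cases hodd : π (c i) = 1
    · refine ⟨c i, hodd, ?_⟩
      rw [(wtDia_eq_one_iff π _).2 hodd, sub_self, (wtDia_eq_zero_iff _).2 rfl]
    · have h0 := zmod_two_ne_one_iff.1 hodd
      refine ⟨c i - 1, by rw [map_sub, h0, map_one]; rfl, ?_⟩
      rw [sub_sub_cancel, (wtDia_eq_one_iff π _).2 (map_one π)]
      have h1 : wtDia (c i) ≠ 0 := fun h => hi ((wtDia_eq_zero_iff _).1 h)
      have h2 : wtDia (c i) ≠ 1 := fun h => hodd ((wtDia_eq_one_iff π _).1 h)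
      have h3 : wtDia (c i) ≤ 2 := by unfold wtDia; split_ifs <;> simp
      omega
  let s : OddSingle π ι := (i, ⟨b, hb⟩)
  have hpar := natCast_sum_wtDia π (c - s.vec)
  have hs : paritySum π ι s.vec = 1 := parity_sum_vec π s
  rw [map_sub, hc, hs, zero_sub, ← ZMod.neg_eq_self_mod_two 1, neg_neg,
    ZMod.natCast_eq_one_iff_odd] at hpar
  have hsum : ∑ j, wtDia ((c - s.vec) j) + 1 = ∑ j, wtDia (c j) := by
    rw [← Finset.add_sum_erase _ _ (Finset.mem_univ i),
      ← Finset.add_sum_erase _ (fun j => wtDia (c j)) (Finset.mem_univ i), ← hw]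
    have : ∀ j ∈ Finset.univ.erase i, wtDia ((c - s.vec) j) = wtDia (c j) := fun j hj => by
      simp [s, OddSingle.vec, (Finset.mem_erase.1 hj).1]
    rw [Finset.sum_congr rfl this]
    simp only [s, OddSingle.vec, Pi.sub_apply, Pi.single_eq_same]
    ring
  have h1 : ∑ j, wtDia ((c - s.vec) j) = 1 := by
    obtain ⟨m, hm⟩ := hpar
    omega
  obtain ⟨t, ht⟩ := (sum_wtDia_eq_one_iff π _).1 h1
  obtain ⟨t', ht'⟩ := s.exists_vec_eq_neg
  exact ⟨t, t', by rw [ht', ← ht]; abel⟩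

end Parity

/-- A linear code `H ⊆ Z_{2^k}^n` (`n = 2^r`) is an `(n, n·2^k, n·2^{k-2})*` code iff
its dual `H^⊥` is a 1'-perfect code in `(Z_{2^k}^n, d^◇)`: `|H^⊥| = 2^{kn}/(n·2^k)`,
the minimum `d^◇`-distance of `H^⊥` is at least `4`, and every word of odd
coordinate sum is at `d^◇`-distance `1` from exactly one codeword of `H^⊥`. -/
theorem stmt_15 (k r : ℕ) (hk : 2 ≤ k)
    (H : Submodule (ZMod (2 ^ k)) (Fin (2 ^ r) → ZMod (2 ^ k))) :
    (Nat.card H = 2 ^ r * 2 ^ k ∧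
      ∀ x ∈ H, ∀ y ∈ H, x ≠ y → 2 ^ r * 2 ^ (k - 2) ≤ dStarK k (2 ^ r) x y) ↔
    ({y : Fin (2 ^ r) → ZMod (2 ^ k) | ∀ x ∈ H, ∑ i, x i * y i = 0}.ncard
        = 2 ^ (k * 2 ^ r) / (2 ^ r * 2 ^ k) ∧
      (∀ x ∈ {y : Fin (2 ^ r) → ZMod (2 ^ k) | ∀ x ∈ H, ∑ i, x i * y i = 0},
        ∀ y ∈ {y : Fin (2 ^ r) → ZMod (2 ^ k) | ∀ x ∈ H, ∑ i, x i * y i = 0},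
          x ≠ y → 4 ≤ dDia (2 ^ r) x y) ∧
      ∀ z : Fin (2 ^ r) → ZMod (2 ^ k), Odd (∑ i, (z i).val) →
        ∃! c, c ∈ {y : Fin (2 ^ r) → ZMod (2 ^ k) | ∀ x ∈ H, ∑ i, x i * y i = 0} ∧
          dDia (2 ^ r) z c = 1) := by
  have hdvd : 2 ∣ 2 ^ k := dvd_pow_self 2 (by omega)
  let π : ZMod (2 ^ k) →+* ZMod 2 := ZMod.castHom hdvd (ZMod 2)
  have hset : {y : Fin (2 ^ r) → ZMod (2 ^ k) | ∀ x ∈ H, ∑ i, x i * y i = 0} =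
      (dualCode H : Set (Fin (2 ^ r) → ZMod (2 ^ k))) := rfl
  have hne : Nonempty (Fin (2 ^ r)) := ⟨⟨0, by positivity⟩⟩
  have hodd : ∀ z : Fin (2 ^ r) → ZMod (2 ^ k),
      Odd (∑ i, (z i).val) ↔ paritySum π _ z = 1 := fun z => by
    have hz : paritySum π _ z = π (∑ i, z i) := rfl
    rw [← ZMod.natCast_eq_one_iff_odd, hz, map_sum, Nat.cast_sum]
    simp only [parity_eq_val π]
  have hstar : (∀ x ∈ H, ∀ y ∈ H, x ≠ y → 2 ^ r * 2 ^ (k - 2) ≤ dStarK k (2 ^ r) x y) ↔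
      ∀ x ∈ H, x ≠ 0 → signSum k x ≤ 0 := by
    have h := le_sum_wtStarK_iff (ι := Fin (2 ^ r)) hk
    rw [Fintype.card_fin] at h
    constructor
    · intro hd x hx hx0
      have := hd 0 H.zero_mem x hx hx0.symm
      rw [← h]
      simpa [dStarK] using this
    · intro hF x hx y hy hxy
      exact (h (y - x)).2 (hF _ (sub_mem hy hx) (sub_ne_zero.2 hxy.symm))
  have hdist : ∀ z c : Fin (2 ^ r) → ZMod (2 ^ k),
      dDia (2 ^ r) z c = 1 ↔ ∃ t : OddSingle π (Fin (2 ^ r)), c + t.vec = z :=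
    sum_wtDia_sub_eq_one_iff π
  have hcard := card_mul_card_dualCode H
  rw [Fintype.card_fin, ← pow_mul] at hcard
  have hncard : (dualCode H : Set (Fin (2 ^ r) → ZMod (2 ^ k))).ncard = Nat.card (dualCode H) :=
    rfl
  rw [hset, hstar, hncard]
  simp only [SetLike.mem_coe, hodd, hdist]
  constructor
  · rintro ⟨hH, hF⟩
    have hH' : Nat.card H = Fintype.card (Fin (2 ^ r)) * 2 ^ k := by rw [Fintype.card_fin, hH]
    obtain ⟨hsep, hhalf⟩ := oddSingle_separated_and_half_mem π H hH' hF
    have heven : ∀ c ∈ dualCode H, paritySum π _ c = 0 := fun c hc =>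
      parity_sum_eq_zero_of_half_mem π hhalf hc
    have hbij := oddTranslate_bijective π hH' heven hsep
    refine ⟨?_, ?_, ?_⟩
    · rw [← hcard, hH, Nat.mul_div_cancel_left _ (by positivity)]
    · intro x hx y hy hxy
      by_contra! hlt
      have hmem := sub_mem hy hx
      obtain ⟨t, t', ht⟩ := exists_sub_of_sum_wtDia_lt π (heven _ hmem)
        (sub_ne_zero.2 hxy.symm) hlt
      rw [hsep t t' (ht ▸ hmem), sub_self, sub_eq_zero] at ht
      exact hxy ht.symm
    · intro z hz
      obtain ⟨⟨c, t⟩, hct⟩ := hbij.2 ⟨z, hz⟩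
      refine ⟨c, ⟨c.2, t, congrArg Subtype.val hct⟩, ?_⟩
      rintro c' ⟨hc', t', ht'⟩
      have := hbij.1 (a₁ := (⟨c', hc'⟩, t')) (a₂ := (c, t)) ((Subtype.ext ht').trans hct.symm)
      exact congrArg (fun p => (p.1 : Fin (2 ^ r) → ZMod (2 ^ k))) this
  · rintro ⟨hD, hd, hz⟩
    have heven : ∀ c ∈ dualCode H, paritySum π _ c = 0 := by
      intro c hc
      rw [← zmod_two_ne_one_iff]
      intro h1
      obtain ⟨c', ⟨hc', h'⟩, -⟩ := hz c h1
      have h1' := (hdist c c').2 h'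
      have hcc : c ≠ c' := by
        rintro rfl
        simp [dDia, wtDia] at h1'
      have := hd c hc c' hc' hcc
      omega
    have hbij : Function.Bijective (oddTranslate π heven) := by
      constructor
      · rintro ⟨⟨c, hc⟩, t⟩ ⟨⟨c', hc'⟩, t'⟩ h
        have h' : c + t.vec = c' + t'.vec := congrArg Subtype.val h
        have hodd' := (oddTranslate π heven (⟨c', hc'⟩, t')).2
        have := (hz _ hodd').unique ⟨hc, t, h'⟩ ⟨hc', t', rfl⟩
        subst this
        simpa using OddSingle.vec_injective π (add_left_cancel h')
      · rintro ⟨z, hzodd⟩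
        obtain ⟨c, ⟨hc, t, ht⟩, -⟩ := hz z hzodd
        exact ⟨(⟨c, hc⟩, t), Subtype.ext ht⟩
    refine ⟨?_, fun x hx hx0 => signSum_nonpos_of_oddTranslate_bijective π heven hbij hx hx0⟩
    have hdiv : 2 ^ r * 2 ^ k ∣ 2 ^ (k * 2 ^ r) := by
      rw [← pow_add]
      apply pow_dvd_pow
      have := Nat.lt_two_pow_self (n := r)
      nlinarith
    have hpos : 0 < Nat.card (dualCode H) := Nat.card_pos
    apply Nat.eq_of_mul_eq_mul_right hpos
    rw [hcard, hD, Nat.mul_div_cancel' hdiv]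
end

section
/- Every linear (n, n·2^k, n·2^{k-2})* code D ⊆ Z_{2^k}^n is equivalent to D_I for some tuple I = (i_1, ..., i_k) of nonnegative integers with 1·i_1 + 2·i_2 + ... + k·i_k = log_2 n, where equivalence means D = z ∘ π(D_I) for a coordinate permutation π and z a vector of units of Z_{2^k}, and D_I is the code generated by the rows of the matrix B_I whose columns are all elements of {1} × (2^{k-1}Z_{2^k})^{i_1} × ... × (2^0 Z_{2^k})^{i_k}. -/
/-- Index type for the rows of `B_I`. -/
def colIdx (k : ℕ) (I : Fin k → ℕ) : Type :=
  Unit ⊕ (Σ j : Fin k, Fin (I j))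

instance (k : ℕ) (I : Fin k → ℕ) : Fintype (colIdx k I) := by
  unfold colIdx; infer_instance

/-- The set `{1} × (2^{k-1}Z_{2^k})^{i_1} × … × (2^0 Z_{2^k})^{i_k}` of columns of `B_I`. -/
def colSet (k : ℕ) (I : Fin k → ℕ) : Set (colIdx k I → ZMod (2 ^ k)) :=
  {v | v (Sum.inl ()) = 1 ∧
    ∀ (j : Fin k) (t : Fin (I j)),
      ∃ c : ZMod (2 ^ k), v (Sum.inr ⟨j, t⟩) = (2 ^ (k - 1 - j.val) : ZMod (2 ^ k)) * c}

section ZModTwoPow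

variable {k : ℕ}

theorem ZMod.two_pow_self_eq_zero (k : ℕ) : (2 : ZMod (2 ^ k)) ^ k = 0 := by
  have := ZMod.natCast_self (2 ^ k)
  push_cast at this
  exact this

theorem ZMod.two_pow_pred_ne_zero (hk : 1 ≤ k) : (2 : ZMod (2 ^ k)) ^ (k - 1) ≠ 0 := by
  intro h
  have h' : ((2 ^ (k - 1) : ℕ) : ZMod (2 ^ k)) = 0 := by push_cast; exact h
  rw [ZMod.natCast_eq_zero_iff] at h'
  have := (Nat.pow_dvd_pow_iff_le_right (by norm_num : 1 < 2)).1 h'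
  omega

theorem ZMod.two_pow_pred_mul_two (hk : 1 ≤ k) : (2 : ZMod (2 ^ k)) ^ (k - 1) * 2 = 0 := by
  rw [← pow_succ, Nat.sub_add_cancel hk, ZMod.two_pow_self_eq_zero]

theorem ZMod.eq_two_mul_or_eq_two_mul_add_one (x : ZMod (2 ^ k)) :
    (∃ y, x = 2 * y) ∨ ∃ y, x = 2 * y + 1 := by
  rcases Nat.even_or_odd' x.val with ⟨m, hm | hm⟩
  · refine Or.inl ⟨m, ?_⟩
    rw [← ZMod.natCast_zmod_val x, hm]
    push_cast
    rfl
  · refine Or.inr ⟨m, ?_⟩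
    rw [← ZMod.natCast_zmod_val x, hm]
    push_cast
    rfl

theorem ZMod.isUnit_two_mul_add_one (y : ZMod (2 ^ k)) : IsUnit (2 * y + 1) :=
  IsNilpotent.isUnit_add_one
    ((Commute.all _ _).isNilpotent_mul_right ⟨k, ZMod.two_pow_self_eq_zero k⟩)

theorem ZMod.two_pow_pred_mul_eq_iff_isUnit (hk : 1 ≤ k) {x : ZMod (2 ^ k)} :
    2 ^ (k - 1) * x = 2 ^ (k - 1) ↔ IsUnit x := by
  have hne := ZMod.two_pow_pred_ne_zero hk
  rcases ZMod.eq_two_mul_or_eq_two_mul_add_one x with ⟨y, rfl⟩ | ⟨y, rfl⟩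
  · have h0 : (2 : ZMod (2 ^ k)) ^ (k - 1) * (2 * y) = 0 := by
      rw [← mul_assoc, ZMod.two_pow_pred_mul_two hk, zero_mul]
    rw [h0]
    exact ⟨fun h => absurd h.symm hne, fun h => absurd (h.mul_left_eq_zero.1 h0) hne⟩
  · refine ⟨fun _ => ZMod.isUnit_two_mul_add_one y, fun _ => ?_⟩
    rw [mul_add, ← mul_assoc, ZMod.two_pow_pred_mul_two hk]
    ring

theorem ZMod.exists_eq_two_pow_mul {j : ℕ} (hj : j < k) {x : ZMod (2 ^ k)}
    (hx : 2 ^ (j + 1) * x = 0) : ∃ c, x = 2 ^ (k - 1 - j) * c := by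
  have h : ((2 ^ (j + 1) * x.val : ℕ) : ZMod (2 ^ k)) = 0 := by
    push_cast
    rwa [ZMod.natCast_zmod_val]
  rw [ZMod.natCast_eq_zero_iff] at h
  have hk : 2 ^ k = 2 ^ (j + 1) * 2 ^ (k - 1 - j) := by
    rw [← pow_add]
    congr 1
    omega
  conv at h => lhs; rw [hk]
  obtain ⟨m, hm⟩ := Nat.dvd_of_mul_dvd_mul_left (by positivity) h
  refine ⟨m, ?_⟩
  rw [← ZMod.natCast_zmod_val x, hm]
  push_cast
  rfl
theorem ZMod.two_mul_eq_zero_iff (hk : 1 ≤ k) {x : ZMod (2 ^ k)} :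
    2 * x = 0 ↔ x = 0 ∨ x = 2 ^ (k - 1) := by
  constructor
  · intro h
    obtain ⟨c, rfl⟩ := ZMod.exists_eq_two_pow_mul (j := 0) hk (by simpa using h)
    rw [Nat.sub_zero]
    rcases ZMod.eq_two_mul_or_eq_two_mul_add_one c with ⟨y, rfl⟩ | ⟨y, rfl⟩
    · left
      rw [← mul_assoc, ZMod.two_pow_pred_mul_two hk, zero_mul]
    · right
      exact (ZMod.two_pow_pred_mul_eq_iff_isUnit hk).2 (ZMod.isUnit_two_mul_add_one y)
  · rintro (rfl | rfl)
    · simp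
    · rw [mul_comm, ZMod.two_pow_pred_mul_two hk]

theorem ZMod.isUnit_of_two_mul_eq_two (hk : 2 ≤ k) {x : ZMod (2 ^ k)} (hx : 2 * x = 2) :
    IsUnit x := by
  rw [← ZMod.two_pow_pred_mul_eq_iff_isUnit (by omega)]
  have h : (2 : ZMod (2 ^ k)) ^ (k - 1) = 2 ^ (k - 2) * 2 := by
    rw [← pow_succ]
    congr 1
    omega
  rw [h, mul_assoc, hx]

/-- The complement `1 - wt*(x) / 2^{k-2}` of the normalized weight, for `2 ≤ k`. -/
def homChar (k : ℕ) (x : ZMod (2 ^ k)) : ℤ :=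
  if x = 0 then 1 else if x = 2 ^ (k - 1) then -1 else 0

theorem wtStarK_eq_homChar (hk : 2 ≤ k) (x : ZMod (2 ^ k)) :
    (wtStarK k x : ℤ) = 2 ^ (k - 2) * (1 - homChar k x) := by
  have h : (2 : ℤ) ^ (k - 1) = 2 ^ (k - 2) * 2 := by
    rw [← pow_succ]
    congr 1
    omega
  unfold wtStarK homChar
  split_ifs
  · simp
  · push_cast
    rw [h]
  · simp

theorem homChar_zero : homChar k 0 = 1 := by simp [homChar]

theorem neg_one_le_homChar (x : ZMod (2 ^ k)) : -1 ≤ homChar k x := by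
  unfold homChar
  split_ifs <;> norm_num

theorem eq_two_pow_pred_of_homChar_eq_neg_one {x : ZMod (2 ^ k)} (hx : homChar k x = -1) :
    x = 2 ^ (k - 1) := by
  by_contra h
  unfold homChar at hx
  split_ifs at hx

theorem homChar_add_two_pow_pred (hk : 1 ≤ k) (x : ZMod (2 ^ k)) :
    homChar k (x + 2 ^ (k - 1)) = -homChar k x := by
  have hne := ZMod.two_pow_pred_ne_zero hk
  have h2 : (2 : ZMod (2 ^ k)) ^ (k - 1) + 2 ^ (k - 1) = 0 := by
    rw [← mul_two, ZMod.two_pow_pred_mul_two hk]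
  by_cases hx : x = 0
  · simp [hx, homChar, hne]
  by_cases hx' : x = 2 ^ (k - 1)
  · simp [hx', homChar, hne, h2]
  have h3 : x + 2 ^ (k - 1) ≠ 0 := fun h => hx' (add_right_cancel (h.trans h2.symm))
  simp [homChar, hx, hx', h3]

theorem homChar_sq (hk : 1 ≤ k) (x : ZMod (2 ^ k)) :
    homChar k x * homChar k x = if 2 * x = 0 then 1 else 0 := by
  rw [ite_congr (propext (ZMod.two_mul_eq_zero_iff hk)) (fun _ => rfl) (fun _ => rfl)]
  unfold homChar
  split_ifs <;> simp_all

theorem ZMod.card_range_two_mul (hk : 1 ≤ k) :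
    Nat.card (AddMonoidHom.mulLeft (2 : ZMod (2 ^ k))).range * 2 = 2 ^ k := by
  set f := AddMonoidHom.mulLeft (2 : ZMod (2 ^ k))
  have h1 := f.ker.card_mul_index
  rw [AddSubgroup.index_ker, Nat.card_zmod] at h1
  have h2 : (f.ker : Set (ZMod (2 ^ k))) = {0, 2 ^ (k - 1)} := by
    ext x
    simpa [f, AddMonoidHom.mem_ker] using ZMod.two_mul_eq_zero_iff hk
  have h3 : Nat.card f.ker = 2 := by
    rw [← SetLike.coe_sort_coe, h2, Nat.card_coe_set_eq,
      Set.ncard_pair (ZMod.two_pow_pred_ne_zero hk).symm]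
  rw [h3, mul_comm] at h1
  exact h1

end ZModTwoPow

section Extremal

variable {k : ℕ} {ι : Type*} {D : Submodule (ZMod (2 ^ k)) (ι → ZMod (2 ^ k))} [Fintype D]

theorem sum_eq_zero_of_add_right_neg {G : Type*} [AddGroup G] [Fintype G] {f : G → ℤ} (y : G)
    (hf : ∀ x, f (x + y) = -f x) : ∑ x, f x = 0 := by
  have h := Equiv.sum_comp (Equiv.addRight y) f
  simp only [Equiv.coe_addRight, hf, Finset.sum_neg_distrib] at h
  linarith

theorem sum_homChar_nonneg (hk : 1 ≤ k) (i : ι) : 0 ≤ ∑ x : D, homChar k (x.1 i) := by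
  by_cases h : ∃ y : D, y.1 i = 2 ^ (k - 1)
  · obtain ⟨y, hy⟩ := h
    refine (sum_eq_zero_of_add_right_neg y fun x => ?_).ge
    rw [Submodule.coe_add, Pi.add_apply, hy, homChar_add_two_pow_pred hk]
  · push Not at h
    refine Finset.sum_nonneg fun x _ => ?_
    unfold homChar
    split_ifs with _ h2
    · norm_num
    · exact absurd h2 (h x)
    · rfl

/-- The correlation of two coordinates is nonnegative, and vanishes only when some codeword
separates them by the element of order two. -/
theorem sum_homChar_mul_nonneg (hk : 1 ≤ k) (i j : ι) :
    0 ≤ ∑ x : D, homChar k (x.1 i) * homChar k (x.1 j) ∧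
      (∑ x : D, homChar k (x.1 i) * homChar k (x.1 j) = 0 →
        ∃ y ∈ D, y i = 0 ∧ y j = 2 ^ (k - 1) ∨ y i = 2 ^ (k - 1) ∧ y j = 0) := by
  by_cases h : ∃ y ∈ D, y i = 0 ∧ y j = 2 ^ (k - 1) ∨ y i = 2 ^ (k - 1) ∧ y j = 0
  · refine ⟨?_, fun _ => h⟩
    obtain ⟨y, hyD, hy⟩ := h
    refine (sum_eq_zero_of_add_right_neg (⟨y, hyD⟩ : D) fun x => ?_).ge
    simp only [Submodule.coe_add, Pi.add_apply]
    rcases hy with ⟨h1, h2⟩ | ⟨h1, h2⟩ <;>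
      rw [h1, h2, homChar_add_two_pow_pred hk, add_zero] <;> ring
  · push Not at h
    have hnn : ∀ x : D, 0 ≤ homChar k (x.1 i) * homChar k (x.1 j) := by
      intro x
      have := h x.1 x.2
      unfold homChar
      split_ifs <;> simp_all
    have hpos : 0 < ∑ x : D, homChar k (x.1 i) * homChar k (x.1 j) := by
      refine Finset.sum_pos' (fun x _ => hnn x) ⟨0, Finset.mem_univ _, ?_⟩
      simp [homChar_zero]
    exact ⟨hpos.le, fun h0 => absurd h0 hpos.ne'⟩

theorem le_sum_homChar_sq (hk : 2 ≤ k) {n : ℕ} (hcard : Nat.card D = n * 2 ^ k) (i : ι) :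
    (2 * n : ℤ) ≤ ∑ x : D, homChar k (x.1 i) * homChar k (x.1 i) ∧
      (∑ x : D, homChar k (x.1 i) * homChar k (x.1 i) = 2 * n → ∃ y ∈ D, IsUnit (y i)) := by
  classical
  set f := AddMonoidHom.mulLeft (2 : ZMod (2 ^ k))
  let g : D →+ ZMod (2 ^ k) :=
    f.comp ((Pi.evalAddMonoidHom (fun _ => ZMod (2 ^ k)) i).comp D.subtype.toAddMonoidHom)
  have hg : ∀ x : D, g x = 2 * x.1 i := fun _ => rfl
  have hf : Nat.card f.range * 2 = 2 ^ k := ZMod.card_range_two_mul (by omega)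
  have hfg : g.range ≤ f.range := by
    rintro _ ⟨x, rfl⟩
    exact ⟨x.1 i, rfl⟩
  have hker : ∑ x : D, homChar k (x.1 i) * homChar k (x.1 i) = (Nat.card g.ker : ℤ) := by
    simp_rw [homChar_sq (k := k) (by omega), ← hg]
    rw [Finset.sum_boole, Nat.card_eq_fintype_card, Fintype.card_subtype]
    simp only [AddMonoidHom.mem_ker]
  have hmul : Nat.card g.ker * Nat.card g.range = n * 2 ^ k := by
    rw [← hcard, ← g.ker.card_mul_index, AddSubgroup.index_ker]
  have hle : Nat.card g.range ≤ Nat.card f.range := AddSubgroup.card_le_of_le hfg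
  have hpos : 0 < Nat.card f.range := Nat.card_pos
  rw [hker]
  have hmul' : Nat.card g.ker * Nat.card g.range = 2 * n * Nat.card f.range := by
    rw [hmul, mul_comm 2 n, mul_assoc, mul_comm 2, hf]
  constructor
  · by_contra! hlt
    have hlt' : Nat.card g.ker < 2 * n := by exact_mod_cast hlt
    nlinarith
  · intro he
    have he' : Nat.card g.ker = 2 * n := by exact_mod_cast he
    have hker_pos : 0 < Nat.card g.ker := Nat.card_pos
    rw [he'] at hmul' hker_pos
    have hcards := Nat.eq_of_mul_eq_mul_left hker_pos hmul'
    have heq : g.range = f.range := AddSubgroup.eq_of_le_of_card_ge hfg hcards.ge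
    have h2 : (2 : ZMod (2 ^ k)) ∈ g.range := by
      rw [heq]
      exact ⟨1, mul_one _⟩
    obtain ⟨x, hx⟩ := h2
    exact ⟨x.1, x.2, ZMod.isUnit_of_two_mul_eq_two hk hx⟩

theorem extremal_properties [Fintype ι] (hk : 2 ≤ k)
    (hcard : Nat.card D = Fintype.card ι * 2 ^ k)
    (hD : ∀ x ∈ D, x ≠ 0 → ∑ i, homChar k (x i) ≤ 0) :
    (∀ i j, i ≠ j → ∃ y ∈ D, y i = 0 ∧ y j = 2 ^ (k - 1) ∨ y i = 2 ^ (k - 1) ∧ y j = 0) ∧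
      (∀ i, ∃ y ∈ D, IsUnit (y i)) ∧
      ∀ x ∈ D, x ≠ 0 → ∑ i, homChar k (x i) = 0 ∨ ∑ i, homChar k (x i) = -(Fintype.card ι : ℤ) := by
  classical
  have hk1 : 1 ≤ k := by omega
  set n : ℤ := (Fintype.card ι : ℤ) with hn
  let F : D → ℤ := fun x => ∑ i, homChar k (x.1 i)
  let A : ι → ι → ℤ := fun i j => ∑ x : D, homChar k (x.1 i) * homChar k (x.1 j)
  have hF0 : F 0 = n := by simp [F, homChar_zero, hn]
  have hFge : ∀ x, -n ≤ F x := fun x => by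
    have := Finset.sum_le_sum fun i (_ : i ∈ Finset.univ) => neg_one_le_homChar (x.1 i)
    simpa [F, hn] using this
  have hFle : ∀ x, x ≠ 0 → F x ≤ 0 := fun x hx => hD x.1 x.2 (by simpa using hx)
  have hS1 : 0 ≤ ∑ x, F x := by
    simp only [F]
    rw [Finset.sum_comm]
    exact Finset.sum_nonneg fun i _ => sum_homChar_nonneg hk1 i
  have hS2 : ∑ x, F x * F x = ∑ i, ∑ j, A i j := by
    simp only [F, A, Finset.sum_mul_sum]
    rw [Finset.sum_comm]
    exact Finset.sum_congr rfl fun i _ => Finset.sum_comm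
  let E : ι → ι → ℤ := fun i j => A i j - if i = j then 2 * n else 0
  have hE : ∀ i j, 0 ≤ E i j := by
    intro i j
    by_cases hij : i = j
    · subst hij
      have := (le_sum_homChar_sq hk hcard i).1
      simp only [E, A, if_true]
      linarith
    · simpa [E, hij] using (sum_homChar_mul_nonneg (D := D) hk1 i j).1
  have hEsum : ∑ i, ∑ j, E i j = ∑ x, F x * F x - 2 * n * n := by
    rw [hS2]
    simp only [E, Finset.sum_sub_distrib, Finset.sum_ite_eq, Finset.mem_univ, if_true,
      Finset.sum_const, Finset.card_univ, nsmul_eq_mul]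
    rw [← hn]
    ring
  let T : D → ℤ := fun x => -(F x * (F x + n)) + if x = 0 then 2 * n * n else 0
  have hT : ∀ x, 0 ≤ T x := by
    intro x
    by_cases hx : x = 0
    · subst hx
      simp only [T, hF0, if_true]
      nlinarith
    · simp only [T, hx, if_false]
      nlinarith [hFge x, hFle x hx]
  have hTsum : ∑ x, T x = -∑ x, F x * F x - n * ∑ x, F x + 2 * n * n := by
    simp only [T, Finset.sum_add_distrib, Finset.sum_neg_distrib, mul_add, Finset.sum_ite_eq',
      Finset.mem_univ, if_true, ← Finset.sum_mul]
    ring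
  have hEnn : 0 ≤ ∑ i, ∑ j, E i j := Finset.sum_nonneg fun i _ => Finset.sum_nonneg fun j _ => hE i j
  have hTnn : 0 ≤ ∑ x, T x := Finset.sum_nonneg fun x _ => hT x
  have hnn : 0 ≤ n * ∑ x, F x := mul_nonneg (by positivity) hS1
  have hE0 : ∑ i, ∑ j, E i j = 0 := by linarith
  have hT0 : ∑ x, T x = 0 := by linarith
  have hE0' : ∀ i j, E i j = 0 := by
    intro i j
    rw [Finset.sum_eq_zero_iff_of_nonneg
      fun i _ => Finset.sum_nonneg fun j _ => hE i j] at hE0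
    have h := hE0 i (Finset.mem_univ _)
    rw [Finset.sum_eq_zero_iff_of_nonneg fun j _ => hE i j] at h
    exact h j (Finset.mem_univ _)
  refine ⟨fun i j hij => ?_, fun i => ?_, fun x hx hx0 => ?_⟩
  · refine (sum_homChar_mul_nonneg hk1 i j).2 ?_
    simpa [E, hij] using hE0' i j
  · refine (le_sum_homChar_sq hk hcard i).2 ?_
    have := hE0' i i
    simp only [E, if_true] at this
    linarith
  · rw [Finset.sum_eq_zero_iff_of_nonneg fun x _ => hT x] at hT0
    have hx0' : (⟨x, hx⟩ : D) ≠ 0 := by simpa using hx0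
    have h := hT0 ⟨x, hx⟩ (Finset.mem_univ _)
    simp only [T, hx0', if_false, add_zero, neg_eq_zero, mul_eq_zero] at h
    exact h.imp_right eq_neg_of_add_eq_zero_left

theorem exists_forall_isUnit [Fintype ι] (hk : 1 ≤ k)
    (hunit : ∀ i, ∃ y ∈ D, IsUnit (y i))
    (hD : ∀ x ∈ D, x ≠ 0 →
      ∑ i, homChar k (x i) = 0 ∨ ∑ i, homChar k (x i) = -(Fintype.card ι : ℤ)) :
    ∃ a ∈ D, ∀ i, IsUnit (a i) := by
  cases isEmpty_or_nonempty ι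
  · exact ⟨0, D.zero_mem, fun i => isEmptyElim i⟩
  have hsum : ∑ x : D, ∑ i, homChar k (2 ^ (k - 1) * x.1 i) = 0 := by
    rw [Finset.sum_comm]
    refine Finset.sum_eq_zero fun i _ => ?_
    obtain ⟨y, hyD, hy⟩ := hunit i
    refine sum_eq_zero_of_add_right_neg (⟨y, hyD⟩ : D) fun x => ?_
    rw [Submodule.coe_add, Pi.add_apply, mul_add, (ZMod.two_pow_pred_mul_eq_iff_isUnit hk).2 hy,
      homChar_add_two_pow_pred hk]
  obtain ⟨a, -, ha⟩ : ∃ a ∈ (Finset.univ : Finset D),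
      ∑ i, homChar k (2 ^ (k - 1) * a.1 i) < 0 := by
    by_contra! h
    rw [Finset.sum_eq_zero_iff_of_nonneg h] at hsum
    have := hsum 0 (Finset.mem_univ _)
    simp [homChar_zero] at this
  refine ⟨a.1, a.2, fun i => ?_⟩
  have hne : (2 : ZMod (2 ^ k)) ^ (k - 1) • a.1 ≠ 0 := by
    intro h0
    have h0' : ∀ i, 2 ^ (k - 1) * a.1 i = 0 := fun i => congrFun h0 i
    simp only [h0', homChar_zero, Finset.sum_const, Finset.card_univ, nsmul_eq_mul, mul_one] at ha
    exact absurd ha (Int.natCast_nonneg _).not_gt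
  have hval := (hD _ (D.smul_mem _ a.2) hne).resolve_left ha.ne
  simp only [Pi.smul_apply, smul_eq_mul] at hval
  rw [← ZMod.two_pow_pred_mul_eq_iff_isUnit hk]
  apply eq_two_pow_pred_of_homChar_eq_neg_one
  have h0 : ∑ i, (homChar k (2 ^ (k - 1) * a.1 i) + 1) = 0 := by
    simp [Finset.sum_add_distrib, hval]
  rw [Finset.sum_eq_zero_iff_of_nonneg
    fun i _ => by linarith [neg_one_le_homChar (2 ^ (k - 1) * a.1 i)]] at h0
  linarith [h0 i (Finset.mem_univ _)]

end Extremal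


/-- A finite abelian group of order `2 ^ r` and exponent dividing `2 ^ k` is generated by families
of elements of orders dividing `2 ^ (j + 1)`, `j < k`, whose orders multiply to `2 ^ r`. -/
theorem AddCommGroup.exists_generators_of_card_eq_two_pow {G : Type*} [AddCommGroup G] [Finite G]
    {k r : ℕ} (hcard : Nat.card G = 2 ^ r) (hexp : ∀ x : G, 2 ^ k • x = 0) :
    ∃ I : Fin k → ℕ, ∑ j, (j.val + 1) * I j = r ∧
      ∃ g : (Σ j : Fin k, Fin (I j)) → G, (∀ p, 2 ^ (p.1.val + 1) • g p = 0) ∧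
        AddSubgroup.closure (Set.range g) = ⊤ := by
  classical
  obtain ⟨ι, _, n, hn, ⟨e⟩⟩ := AddCommGroup.equiv_directSum_zmod_of_finite' G
  have hprod : ∏ i, n i = 2 ^ r := by
    rw [← hcard, Nat.card_congr (e.toEquiv.trans DFinsupp.equivFunOnFintype), Nat.card_pi]
    simp
  have hpow : ∀ i, ∃ m, n i = 2 ^ m := fun i => by
    have hdvd : n i ∣ 2 ^ r := hprod ▸ Finset.dvd_prod_of_mem n (Finset.mem_univ i)
    obtain ⟨m, -, hm⟩ := (Nat.dvd_prime_pow Nat.prime_two).1 hdvd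
    exact ⟨m, hm⟩
  choose m hm using hpow
  let gen : ι → G := fun i => e.symm (DirectSum.of (fun i => ZMod (n i)) i 1)
  have hgen : ∀ i, n i • gen i = 0 := fun i => by
    rw [← map_nsmul, ← map_nsmul, nsmul_one, ZMod.natCast_self, map_zero, map_zero]
  have hm1 : ∀ i, 1 ≤ m i := fun i => by
    by_contra h
    have := hn i
    rw [hm, show m i = 0 by omega] at this
    norm_num at this
  have hmk : ∀ i, m i ≤ k := fun i => by
    have h := hexp (gen i)
    rw [← map_nsmul, map_eq_zero_iff e.symm e.symm.injective, ← map_nsmul,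
      map_eq_zero_iff _ (DirectSum.of_injective i), nsmul_one, ZMod.natCast_eq_zero_iff, hm] at h
    exact (Nat.pow_dvd_pow_iff_le_right (by norm_num)).1 h
  have hclosure : AddSubgroup.closure (Set.range gen) = ⊤ := by
    rw [eq_top_iff]
    rintro x -
    obtain ⟨y, rfl⟩ := e.symm.surjective x
    induction y using DirectSum.induction_on with
    | zero => simp
    | of i a =>
      have : NeZero (n i) := ⟨by have := hn i; omega⟩
      have ha : DirectSum.of (fun i => ZMod (n i)) i a =
          a.val • DirectSum.of (fun i => ZMod (n i)) i 1 := by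
        rw [← map_nsmul, nsmul_one, ZMod.natCast_zmod_val]
      rw [ha, map_nsmul]
      exact AddSubgroup.nsmul_mem _ (AddSubgroup.subset_closure (Set.mem_range_self i)) _
    | add x y hx hy =>
      rw [map_add]
      exact AddSubgroup.add_mem _ hx hy
  let idx : ι → Fin k := fun i => ⟨m i - 1, by have := hm1 i; have := hmk i; omega⟩
  have hidx : ∀ i, (idx i).val + 1 = m i := fun i => Nat.sub_add_cancel (hm1 i)
  let σ : (Σ j : Fin k, Fin (Fintype.card {i // idx i = j})) ≃ ι :=
    (Equiv.sigmaCongrRight fun j => (Fintype.equivFin {i // idx i = j}).symm).trans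
      (Equiv.sigmaFiberEquiv idx)
  have hσ : ∀ p, idx (σ p) = p.1 := fun p => ((Fintype.equivFin _).symm p.2).2
  refine ⟨fun j => Fintype.card {i // idx i = j}, ?_, gen ∘ σ, fun p => ?_, ?_⟩
  · apply Nat.pow_right_injective le_rfl
    change 2 ^ _ = 2 ^ r
    rw [← hprod, Finset.prod_congr rfl fun i _ => hm i, Finset.prod_pow_eq_pow_sum]
    congr 1
    rw [← Equiv.sum_comp σ, Fintype.sum_sigma]
    refine Finset.sum_congr rfl fun j _ => ?_
    simp_rw [← hidx, hσ]
    simp [mul_comm]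
  · rw [← hσ p, hidx, ← hm]
    exact hgen _
  · rw [σ.surjective.range_comp, hclosure]

theorem ncard_colSet_le {k : ℕ} (I : Fin k → ℕ) :
    (colSet k I).ncard ≤ 2 ^ ∑ j, (j.val + 1) * I j := by
  classical
  let f : (∀ p : Σ j : Fin k, Fin (I j), Fin (2 ^ (p.1.val + 1))) → colIdx k I → ZMod (2 ^ k) :=
    fun c => Sum.elim (fun _ => 1) fun p => 2 ^ (k - 1 - p.1.val) * ((c p).val : ZMod (2 ^ k))
  have hsub : colSet k I ⊆ Set.range f := by
    rintro v ⟨hv1, hv2⟩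
    choose c hc using hv2
    refine ⟨fun p => ⟨(c p.1 p.2).val % 2 ^ (p.1.val + 1), Nat.mod_lt _ (by positivity)⟩, ?_⟩
    funext t
    rcases t with _ | ⟨j, t⟩
    · exact hv1.symm
    · have hpow : (2 : ZMod (2 ^ k)) ^ (k - 1 - j.val) * 2 ^ (j.val + 1) = 0 := by
        rw [← pow_add, show k - 1 - j.val + (j.val + 1) = k by have := j.2; omega,
          ZMod.two_pow_self_eq_zero]
      have hdiv := congrArg (Nat.cast (R := ZMod (2 ^ k)))
        (Nat.mod_add_div (c j t).val (2 ^ (j.val + 1)))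
      rw [ZMod.natCast_zmod_val, Nat.cast_add, Nat.cast_mul, Nat.cast_pow, Nat.cast_ofNat] at hdiv
      rw [hc j t, ← hdiv, mul_add, ← mul_assoc, hpow, zero_mul, add_zero]
      rfl
  calc (colSet k I).ncard ≤ (Set.range f).ncard := Set.ncard_le_ncard hsub (Set.toFinite _)
    _ ≤ Nat.card (∀ p : Σ j : Fin k, Fin (I j), Fin (2 ^ (p.1.val + 1))) := by
      rw [← Set.image_univ, ← Set.ncard_univ]
      exact Set.ncard_image_le
    _ = 2 ^ ∑ j, (j.val + 1) * I j := by
      rw [Nat.card_pi]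
      simp [Finset.prod_pow_eq_pow_sum, Fintype.sum_sigma, mul_comm]

/-- Every linear `(n, n·2^k, n·2^{k-2})*` code `D ⊆ Z_{2^k}^n` (`n = 2^r`) is
equivalent to `D_I` for some tuple `I = (i_1,…,i_k)` with `Σ j·i_j = r`:
`D = z ∘ π(D_I)` for a coordinate permutation `π` and a vector `z` of units,
where `D_I` is generated by the rows of a matrix `B_I` whose columns enumerate
`{1} × (2^{k-1}Z_{2^k})^{i_1} × … × (2^0 Z_{2^k})^{i_k}`. -/
theorem stmt_19 (k r : ℕ) (hk : 2 ≤ k)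
    (D : Submodule (ZMod (2 ^ k)) (Fin (2 ^ r) → ZMod (2 ^ k)))
    (hcard : Nat.card D = 2 ^ r * 2 ^ k)
    (hdist : ∀ x ∈ D, ∀ y ∈ D, x ≠ y →
      2 ^ r * 2 ^ (k - 2) ≤ dStarK k (2 ^ r) x y) :
    ∃ (I : Fin k → ℕ), (∑ j, (j.val + 1) * I j = r) ∧
      ∃ (b : Fin (2 ^ r) → colIdx k I → ZMod (2 ^ k)),
        Function.Injective b ∧ Set.range b = colSet k I ∧
        ∃ (π : Equiv.Perm (Fin (2 ^ r))) (z : Fin (2 ^ r) → ZMod (2 ^ k)),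
          (∀ i, IsUnit (z i)) ∧
          (D : Set (Fin (2 ^ r) → ZMod (2 ^ k)))
            = (fun (x : Fin (2 ^ r) → ZMod (2 ^ k)) => fun i => z i * x (π i)) ''
              (Submodule.span (ZMod (2 ^ k))
                (Set.range fun t : colIdx k I => fun i : Fin (2 ^ r) => b i t) :
                  Set (Fin (2 ^ r) → ZMod (2 ^ k))) := by
  classical
  have hk1 : 1 ≤ k := by omega
  have : Fintype D := Fintype.ofFinite D
  have hD : ∀ x ∈ D, x ≠ 0 → ∑ i, homChar k (x i) ≤ 0 := by
    intro x hx hx0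
    have h := hdist 0 D.zero_mem x hx hx0.symm
    have h' : ((2 ^ r * 2 ^ (k - 2) : ℕ) : ℤ) ≤ 2 ^ (k - 2) * (2 ^ r - ∑ i, homChar k (x i)) := by
      refine (Int.ofNat_le.2 h).trans_eq ?_
      simp [dStarK, wtStarK_eq_homChar hk, ← Finset.mul_sum, Finset.sum_sub_distrib]
    push_cast at h'
    rw [mul_comm] at h'
    have := le_of_mul_le_mul_left h' (by positivity)
    linarith
  obtain ⟨hsep, hunit, hval⟩ := extremal_properties hk (by rw [hcard, Fintype.card_fin]) hD
  obtain ⟨a, haD, ha⟩ := exists_forall_isUnit hk1 hunit hval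
  let i₀ : Fin (2 ^ r) := ⟨0, by positivity⟩
  let ev : D →+ ZMod (2 ^ k) :=
    (Pi.evalAddMonoidHom (fun _ => ZMod (2 ^ k)) i₀).comp D.subtype.toAddMonoidHom
  have hev : ∀ x : D, ev x = x.1 i₀ := fun _ => rfl
  obtain ⟨u, hu⟩ := ha i₀
  have hsurj : Function.Surjective ev := fun c => by
    refine ⟨⟨(c * ↑u⁻¹ : ZMod (2 ^ k)) • a, D.smul_mem _ haD⟩, ?_⟩
    rw [hev]
    simp [← hu]
  have hker : Nat.card ev.ker = 2 ^ r := by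
    have h := ev.ker.card_mul_index
    rw [AddSubgroup.index_ker, AddMonoidHom.range_eq_top.2 hsurj, AddSubgroup.card_top,
      Nat.card_zmod, hcard] at h
    exact Nat.eq_of_mul_eq_mul_right (by positivity) h
  obtain ⟨I, hI, g, hg, hspan⟩ := AddCommGroup.exists_generators_of_card_eq_two_pow (k := k) hker
    (fun x => by
      ext i
      simp)
  choose z hz using ha
  let row : colIdx k I → Fin (2 ^ r) → ZMod (2 ^ k) := Sum.elim (fun _ => a) fun p => (g p).1.1
  let b : Fin (2 ^ r) → colIdx k I → ZMod (2 ^ k) := fun i t => ↑(z i)⁻¹ * row t i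
  have hab : ∀ i t, a i * b i t = row t i := fun i t => by
    simp [b, ← hz]
  let L : (Fin (2 ^ r) → ZMod (2 ^ k)) →ₗ[ZMod (2 ^ k)] (Fin (2 ^ r) → ZMod (2 ^ k)) :=
    LinearMap.pi fun i => a i • LinearMap.proj i
  have hrow : Submodule.span (ZMod (2 ^ k)) (Set.range row) = D := by
    apply le_antisymm
    · rw [Submodule.span_le]
      rintro _ ⟨t | p, rfl⟩
      · exact haD
      · exact (g p).1.2
    · have hmem : ∀ m : ev.ker, m.1.1 ∈ Submodule.span (ZMod (2 ^ k)) (Set.range row) := by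
        intro m
        have hm : m ∈ AddSubgroup.closure (Set.range g) := hspan ▸ AddSubgroup.mem_top m
        induction hm using AddSubgroup.closure_induction with
        | mem x hx =>
          obtain ⟨p, rfl⟩ := hx
          exact Submodule.subset_span ⟨Sum.inr p, rfl⟩
        | zero => exact Submodule.zero_mem _
        | add x y _ _ hx hy => exact Submodule.add_mem _ hx hy
        | neg x _ hx => exact Submodule.neg_mem _ hx
      intro x hx
      let c : ZMod (2 ^ k) := x i₀ * ↑u⁻¹
      have hdiff : (⟨x, hx⟩ - c • ⟨a, haD⟩ : D) ∈ ev.ker := by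
        rw [AddMonoidHom.mem_ker, hev]
        simp [c, ← hu]
      have := Submodule.add_mem _ (hmem ⟨_, hdiff⟩)
        (Submodule.smul_mem _ c (Submodule.subset_span ⟨Sum.inl (), rfl⟩))
      simpa [row] using this
  have hinj : Function.Injective b := by
    intro i j hij
    by_contra hne
    have hle : D ≤ LinearMap.ker
        (((z i)⁻¹ : (ZMod (2 ^ k))ˣ).1 • LinearMap.proj (R := ZMod (2 ^ k))
          (φ := fun _ : Fin (2 ^ r) => ZMod (2 ^ k)) i -
        ((z j)⁻¹ : (ZMod (2 ^ k))ˣ).1 • LinearMap.proj j) := by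
      rw [← hrow, Submodule.span_le]
      rintro _ ⟨t, rfl⟩
      simpa [b, sub_eq_zero] using congrFun hij t
    have h0 := ZMod.two_pow_pred_ne_zero hk1
    obtain ⟨y, hy, h⟩ := hsep i j hne
    have hy' := hle hy
    rcases h with ⟨h1, h2⟩ | ⟨h1, h2⟩ <;> simp [h1, h2, h0] at hy'
  have hsub : Set.range b ⊆ colSet k I := by
    rintro _ ⟨i, rfl⟩
    refine ⟨?_, fun j t => ZMod.exists_eq_two_pow_mul j.2 ?_⟩
    · simp [b, row, ← hz]
    · have h : (2 : ZMod (2 ^ k)) ^ (j.val + 1) * (g ⟨j, t⟩).1.1 i = 0 := by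
        simpa using congrArg (fun m : ev.ker => m.1.1 i) (hg ⟨j, t⟩)
      change 2 ^ (j.val + 1) * (_ * (g ⟨j, t⟩).1.1 i) = 0
      rw [mul_left_comm, h, mul_zero]
  have hrange : Set.range b = colSet k I := by
    refine Set.eq_of_subset_of_ncard_le hsub ?_ (Set.toFinite _)
    rw [← Set.image_univ, Set.ncard_image_of_injective _ hinj, Set.ncard_univ, Nat.card_fin, ← hI]
    exact ncard_colSet_le I
  refine ⟨I, hI, b, hinj, hrange, 1, a, fun i => hz i ▸ (z i).isUnit, ?_⟩
  have hLrow : L '' Set.range (fun t i => b i t) = Set.range row := by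
    rw [← Set.range_comp]
    congr 1
    funext t i
    exact hab i t
  rw [← hrow, ← hLrow, ← Submodule.map_span]
  rfl
end
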